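/- arXiv:1009.4724 — 4 statements merged into one kernel-verified Lean document; each statement's English description precedes it below -/
import Mathlib

section
/- The set M = {(ε1, ε2, ε3, ε4) ∈ ℚ^4 : εi ∈ {1, −1} for each i} of all 16 sign vectors in ℚ^4 is hereditarily normal, i.e., every subset of M is saturated. -/
/-- `v` is a linear combination of the vectors in `M` with integer coefficients. -/
def memZSpan {n : ℕ} (M : Finset (Fin n → ℚ)) (v : Fin n → ℚ) : Prop :=
  ∃ c : (Fin n → ℚ) → ℤ, v = ∑ w ∈ M, (c w : ℚ) • w

/-- `v` is a linear combination of the vectors in `M` with nonnegative rational coefficients. -/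
def memQnnSpan {n : ℕ} (M : Finset (Fin n → ℚ)) (v : Fin n → ℚ) : Prop :=
  ∃ q : (Fin n → ℚ) → ℚ, (∀ w, 0 ≤ q w) ∧ v = ∑ w ∈ M, q w • w

/-- `v` is a linear combination of the vectors in `M` with nonnegative integer coefficients. -/
def memNSpan {n : ℕ} (M : Finset (Fin n → ℚ)) (v : Fin n → ℚ) : Prop :=
  ∃ a : (Fin n → ℚ) → ℕ, v = ∑ w ∈ M, (a w : ℚ) • w

/-- A finite set `M ⊆ ℚ^n` is saturated if `ℤ≥0(M) = ℤ(M) ∩ ℚ≥0(M)`. -/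
def Saturated {n : ℕ} (M : Finset (Fin n → ℚ)) : Prop :=
  ∀ v : Fin n → ℚ, memZSpan M v → memQnnSpan M v → memNSpan M v

theorem det_fin_four_laplace (A : Matrix (Fin 4) (Fin 4) ℤ) :
    A.det =
      (A 0 0 * A 1 1 - A 0 1 * A 1 0) * (A 2 2 * A 3 3 - A 2 3 * A 3 2)
      - (A 0 0 * A 1 2 - A 0 2 * A 1 0) * (A 2 1 * A 3 3 - A 2 3 * A 3 1)
      + (A 0 0 * A 1 3 - A 0 3 * A 1 0) * (A 2 1 * A 3 2 - A 2 2 * A 3 1)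
      + (A 0 1 * A 1 2 - A 0 2 * A 1 1) * (A 2 0 * A 3 3 - A 2 3 * A 3 0)
      - (A 0 1 * A 1 3 - A 0 3 * A 1 1) * (A 2 0 * A 3 2 - A 2 2 * A 3 0)
      + (A 0 2 * A 1 3 - A 0 3 * A 1 2) * (A 2 0 * A 3 1 - A 2 1 * A 3 0) := by
  simp only [Matrix.det_succ_row_zero, Fin.sum_univ_succ, Matrix.submatrix_apply,
    Matrix.det_unique, Fin.succAbove, Fin.default_eq_zero]
  simp [Fin.lt_def, Fin.succ, Fin.castSucc, Fin.castAdd, Fin.castLE]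
  ring

theorem eight_dvd_det_of_odd (A : Matrix (Fin 4) (Fin 4) ℤ) (hA : ∀ i j, Odd (A i j)) :
    8 ∣ A.det := by
  choose B hB using hA
  refine ⟨(Matrix.of ![fun j => 2 * B 0 j + 1, fun j => B 1 j - B 0 j,
    fun j => B 2 j - B 0 j, fun j => B 3 j - B 0 j]).det, ?_⟩
  rw [det_fin_four_laplace, det_fin_four_laplace]
  simp [hB]
  ring

/-- Hadamard's bound for a sign matrix of order four. -/
theorem abs_det_le_sixteen (A : Matrix (Fin 4) (Fin 4) ℤ) (hA : ∀ i j, A i j = 1 ∨ A i j = -1) :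
    |A.det| ≤ 16 := by
  have hsq : ∀ i j, A i j ^ 2 = 1 := fun i j => by
    rcases hA i j with h | h <;> simp [h]
  have gram : ∀ i k,
      (A i 0 * A k 1 - A i 1 * A k 0) ^ 2 + (A i 0 * A k 2 - A i 2 * A k 0) ^ 2
      + (A i 0 * A k 3 - A i 3 * A k 0) ^ 2 + (A i 1 * A k 2 - A i 2 * A k 1) ^ 2
      + (A i 1 * A k 3 - A i 3 * A k 1) ^ 2 + (A i 2 * A k 3 - A i 3 * A k 2) ^ 2 ≤ 16 := by
    intro i k
    have lagrange :
        (A i 0 * A k 1 - A i 1 * A k 0) ^ 2 + (A i 0 * A k 2 - A i 2 * A k 0) ^ 2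
        + (A i 0 * A k 3 - A i 3 * A k 0) ^ 2 + (A i 1 * A k 2 - A i 2 * A k 1) ^ 2
        + (A i 1 * A k 3 - A i 3 * A k 1) ^ 2 + (A i 2 * A k 3 - A i 3 * A k 2) ^ 2
        = (A i 0 ^ 2 + A i 1 ^ 2 + A i 2 ^ 2 + A i 3 ^ 2)
          * (A k 0 ^ 2 + A k 1 ^ 2 + A k 2 ^ 2 + A k 3 ^ 2)
          - (A i 0 * A k 0 + A i 1 * A k 1 + A i 2 * A k 2 + A i 3 * A k 3) ^ 2 := by ring
    rw [lagrange]
    simp only [hsq]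
    linarith [sq_nonneg (A i 0 * A k 0 + A i 1 * A k 1 + A i 2 * A k 2 + A i 3 * A k 3)]
  have h₁ := gram 0 1
  have h₂ := gram 2 3
  rw [det_fin_four_laplace, abs_le]
  generalize A 0 0 * A 1 1 - A 0 1 * A 1 0 = m₁, A 0 0 * A 1 2 - A 0 2 * A 1 0 = m₂,
    A 0 0 * A 1 3 - A 0 3 * A 1 0 = m₃, A 0 1 * A 1 2 - A 0 2 * A 1 1 = m₄,
    A 0 1 * A 1 3 - A 0 3 * A 1 1 = m₅, A 0 2 * A 1 3 - A 0 3 * A 1 2 = m₆,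
    A 2 2 * A 3 3 - A 2 3 * A 3 2 = n₁, A 2 1 * A 3 3 - A 2 3 * A 3 1 = n₂,
    A 2 1 * A 3 2 - A 2 2 * A 3 1 = n₃, A 2 0 * A 3 3 - A 2 3 * A 3 0 = n₄,
    A 2 0 * A 3 2 - A 2 2 * A 3 0 = n₅, A 2 0 * A 3 1 - A 2 1 * A 3 0 = n₆ at *
  constructor
  · linarith [sq_nonneg (m₁ + n₁), sq_nonneg (m₂ - n₂), sq_nonneg (m₃ + n₃),
      sq_nonneg (m₄ + n₄), sq_nonneg (m₅ - n₅), sq_nonneg (m₆ + n₆)]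
  · linarith [sq_nonneg (m₁ - n₁), sq_nonneg (m₂ + n₂), sq_nonneg (m₃ - n₃),
      sq_nonneg (m₄ - n₄), sq_nonneg (m₅ + n₅), sq_nonneg (m₆ - n₆)]

/-- Twice a sign vector has integral coordinates in any basis of sign vectors, and every odd
coordinate is `1` or `-1`. -/
theorem exists_double_coords (A : Matrix (Fin 4) (Fin 4) ℤ)
    (hA : ∀ i j, A i j = 1 ∨ A i j = -1) (hdet : A.det ≠ 0) (s : Fin 4 → ℤ)
    (hs : ∀ i, s i = 1 ∨ s i = -1) :
    ∃ d : Fin 4 → ℤ, A.mulVec d = (2 : ℤ) • s ∧ ∀ j, Even (d j) ∨ d j = 1 ∨ d j = -1 := by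
  have odd_of : ∀ x : ℤ, x = 1 ∨ x = -1 → Odd x := by
    rintro x (rfl | rfl) <;> decide
  have hup : ∀ j i k, A.updateCol j s i k = 1 ∨ A.updateCol j s i k = -1 := by
    intro j i k
    rw [Matrix.updateCol_apply]
    split
    · exact hs i
    · exact hA i k
  have hcr := Matrix.mulVec_cramer A s
  have hdvd : ∀ j, ∃ e, A.cramer s j = 8 * e := fun j => by
    rw [Matrix.cramer_apply]
    exact eight_dvd_det_of_odd _ fun i k => odd_of _ (hup j i k)
  have hle : ∀ j, |A.cramer s j| ≤ 16 := fun j => by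
    rw [Matrix.cramer_apply]
    exact abs_det_le_sixteen _ (hup j)
  choose e he using hdvd
  have he2 : ∀ j, -2 ≤ e j ∧ e j ≤ 2 := fun j => by
    have := abs_le.1 (hle j)
    rw [he] at this
    omega
  have hce : A.cramer s = (8 : ℤ) • e := by
    ext j
    simp [he]
  obtain ⟨m, hm⟩ := eight_dvd_det_of_odd A fun i k => odd_of _ (hA i k)
  have hm2 := abs_le.1 (abs_det_le_sixteen A hA)
  rw [hce, Matrix.mulVec_smul, hm, mul_smul] at hcr
  have hcr' : A.mulVec e = m • s := smul_right_injective _ (by norm_num : (8 : ℤ) ≠ 0) hcr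
  rw [hm] at hdet hm2
  have hm0 : m = 1 ∨ m = -1 ∨ m = 2 ∨ m = -2 := by omega
  rcases hm0 with rfl | rfl | rfl | rfl
  · exact ⟨(2 : ℤ) • e, by rw [Matrix.mulVec_smul, hcr', one_smul], fun j => .inl (by simp)⟩
  · refine ⟨(-2 : ℤ) • e, by rw [Matrix.mulVec_smul, hcr', smul_smul]; norm_num,
      fun j => .inl (by simp)⟩
  · refine ⟨e, hcr', fun j => ?_⟩
    have := he2 j
    rw [Int.even_iff]
    omega
  · refine ⟨-e, by rw [Matrix.mulVec_neg, hcr']; simp, fun j => ?_⟩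
    have := he2 j
    rw [Int.even_iff, Pi.neg_apply]
    omega

/-- If exactly two of the half-integral coordinates of a sign vector are non-integral, the
corresponding basis vectors agree up to sign. -/
theorem exists_sign_of_two_odd {x y z w s : Fin 4 → ℤ} {a b c d : ℤ}
    (hx : ∀ i, x i = 1 ∨ x i = -1) (hy : ∀ i, y i = 1 ∨ y i = -1)
    (hz : ∀ i, z i = 1 ∨ z i = -1) (hw : ∀ i, w i = 1 ∨ w i = -1)
    (hs : ∀ i, s i = 1 ∨ s i = -1) (ha : a = 1 ∨ a = -1) (hb : b = 1 ∨ b = -1)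
    (hc : Even c) (hd : Even d)
    (h : ∀ i, x i * a + y i * b + z i * c + w i * d = 2 * s i) :
    ∃ σ : ℤ, ∀ i, x i = σ * y i := by
  obtain ⟨k, rfl⟩ := hc
  obtain ⟨l, rfl⟩ := hd
  have key : ∀ i, x i * a * (y i * b) = if (1 + k + l) % 2 = 1 then 1 else -1 := by
    intro i
    have hi := h i
    have hxa : x i * a = 1 ∨ x i * a = -1 := by
      rcases hx i with h1 | h1 <;> rcases ha with h2 | h2 <;> simp [h1, h2]
    have hyb : y i * b = 1 ∨ y i * b = -1 := by
      rcases hy i with h1 | h1 <;> rcases hb with h2 | h2 <;> simp [h1, h2]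
    rcases hz i with h1 | h1 <;> rcases hw i with h2 | h2 <;> rcases hs i with h3 | h3 <;>
      rcases hxa with h4 | h4 <;> rcases hyb with h5 | h5 <;>
      rw [h1, h2, h3, h4, h5] at hi <;> rw [h4, h5] <;> split_ifs <;> omega
  refine ⟨(if (1 + k + l) % 2 = 1 then 1 else -1) * a * b, fun i => ?_⟩
  rw [← key i]
  have ha2 : a * a = 1 := by rcases ha with rfl | rfl <;> rfl
  have hb2 : b * b = 1 := by rcases hb with rfl | rfl <;> rfl
  have hy2 : y i * y i = 1 := by rcases hy i with h | h <;> rw [h] <;> rfl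
  linear_combination (-(x i) * b * b * y i * y i) * ha2 - x i * y i * y i * hb2 - x i * hy2

theorem col_ne_mul_col {A : Matrix (Fin 4) (Fin 4) ℤ} (hdet : A.det ≠ 0) {p q : Fin 4}
    (hpq : p ≠ q) (σ : ℤ) : ¬ ∀ i, A i p = σ * A i q := by
  intro h
  have h0 : A.mulVec (Pi.single p 1 - Pi.single q σ) = 0 := by
    ext i
    simp [Matrix.mulVec_sub, h i, mul_comm]
  have := congrFun (Matrix.eq_zero_of_mulVec_eq_zero hdet h0) p
  simp [hpq] at this

/-- A sign vector has either only integral coordinates in a basis of sign vectors, or all its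
coordinates are `1 / 2` or `-1 / 2`. -/
theorem exists_double_coords_even_or_unit (A : Matrix (Fin 4) (Fin 4) ℤ)
    (hA : ∀ i j, A i j = 1 ∨ A i j = -1) (hdet : A.det ≠ 0) (s : Fin 4 → ℤ)
    (hs : ∀ i, s i = 1 ∨ s i = -1) :
    ∃ d : Fin 4 → ℤ, A.mulVec d = (2 : ℤ) • s ∧
      ((∀ j, Even (d j)) ∨ ∀ j, d j = 1 ∨ d j = -1) := by
  obtain ⟨d, hd, hpar⟩ := exists_double_coords A hA hdet s hs
  refine ⟨d, hd, ?_⟩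
  have hrow : ∀ i, A i 0 * d 0 + A i 1 * d 1 + A i 2 * d 2 + A i 3 * d 3 = 2 * s i := by
    intro i
    simpa [Matrix.mulVec, dotProduct, Fin.sum_univ_four] using congrFun hd i
  have two_odd : ∀ p q r t : Fin 4, p ≠ q →
      (∀ i, A i p * d p + A i q * d q + A i r * d r + A i t * d t = 2 * s i) →
      ¬ ((d p = 1 ∨ d p = -1) ∧ (d q = 1 ∨ d q = -1) ∧ Even (d r) ∧ Even (d t)) := by
    rintro p q r t hpq h ⟨hp, hq, hr, ht⟩
    obtain ⟨σ, hσ⟩ := exists_sign_of_two_odd (hA · p) (hA · q) (hA · r) (hA · t) hs hp hq hr ht h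
    exact col_ne_mul_col hdet hpq σ hσ
  have hsum : Even (d 0 + d 1 + d 2 + d 3) := by
    have h := hrow 0
    rw [Int.even_iff]
    rcases hA 0 0 with h0 | h0 <;> rcases hA 0 1 with h1 | h1 <;> rcases hA 0 2 with h2 | h2 <;>
      rcases hA 0 3 with h3 | h3 <;> rw [h0, h1, h2, h3] at h <;> omega
  have not_only_01 := two_odd 0 1 2 3 (by decide) (fun i => by linarith [hrow i])
  have not_only_02 := two_odd 0 2 1 3 (by decide) (fun i => by linarith [hrow i])
  have not_only_03 := two_odd 0 3 1 2 (by decide) (fun i => by linarith [hrow i])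
  have not_only_12 := two_odd 1 2 0 3 (by decide) (fun i => by linarith [hrow i])
  have not_only_13 := two_odd 1 3 0 2 (by decide) (fun i => by linarith [hrow i])
  have not_only_23 := two_odd 2 3 0 1 (by decide) (fun i => by linarith [hrow i])
  have hall : (Even (d 0) ∧ Even (d 1) ∧ Even (d 2) ∧ Even (d 3)) ∨
      ((d 0 = 1 ∨ d 0 = -1) ∧ (d 1 = 1 ∨ d 1 = -1) ∧ (d 2 = 1 ∨ d 2 = -1) ∧
        (d 3 = 1 ∨ d 3 = -1)) := by
    rcases hpar 0 with h0 | h0 <;> rcases hpar 1 with h1 | h1 <;>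
      rcases hpar 2 with h2 | h2 <;> rcases hpar 3 with h3 | h3 <;>
      first
      | exact .inl ⟨h0, h1, h2, h3⟩
      | exact .inr ⟨h0, h1, h2, h3⟩
      | exact (not_only_01 ⟨h0, h1, h2, h3⟩).elim
      | exact (not_only_02 ⟨h0, h2, h1, h3⟩).elim
      | exact (not_only_03 ⟨h0, h3, h1, h2⟩).elim
      | exact (not_only_12 ⟨h1, h2, h0, h3⟩).elim
      | exact (not_only_13 ⟨h1, h3, h0, h2⟩).elim
      | exact (not_only_23 ⟨h2, h3, h0, h1⟩).elim
      | (clear not_only_01 not_only_02 not_only_03 not_only_12 not_only_13 not_only_23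
         simp only [Int.even_iff] at *
         omega)
  rcases hall with ⟨h0, h1, h2, h3⟩ | ⟨h0, h1, h2, h3⟩
  · exact .inl fun j => by fin_cases j <;> assumption
  · exact .inr fun j => by fin_cases j <;> assumption

/-- Coordinates of a sign vector in a basis of sign vectors, doubled. -/
theorem exists_double_repr (b : Module.Basis (Fin 4) ℚ (Fin 4 → ℚ))
    (hb : ∀ j i, b j i = 1 ∨ b j i = -1) (s : Fin 4 → ℚ) (hs : ∀ i, s i = 1 ∨ s i = -1) :
    ∃ d : Fin 4 → ℤ, (∀ j, 2 * b.repr s j = d j) ∧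
      ((∀ j, Even (d j)) ∨ ∀ j, d j = 1 ∨ d j = -1) := by
  have lift_sign : ∀ x : ℚ, x = 1 ∨ x = -1 → ∃ z : ℤ, (z = 1 ∨ z = -1) ∧ (z : ℚ) = x := by
    rintro x (rfl | rfl)
    · exact ⟨1, by simp⟩
    · exact ⟨-1, by simp⟩
  choose A hA hAb using fun i j => lift_sign _ (hb j i)
  choose t ht hts using fun i => lift_sign _ (hs i)
  have hmat : (Matrix.of A).map (Int.castRingHom ℚ) = (Pi.basisFun ℚ (Fin 4)).toMatrix b := by
    ext i j
    simp [hAb, Module.Basis.toMatrix_apply]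
  have hdet : (Matrix.of A).det ≠ 0 := by
    intro h0
    have hu : IsUnit ((Pi.basisFun ℚ (Fin 4)).toMatrix b).det := by
      rw [← Module.Basis.det_apply]
      exact (Pi.basisFun ℚ (Fin 4)).isUnit_det b
    apply hu.ne_zero
    rw [← hmat, ← RingHom.mapMatrix_apply, ← RingHom.map_det, h0, map_zero]
  obtain ⟨d, hd, hpar⟩ := exists_double_coords_even_or_unit (Matrix.of A) hA hdet t ht
  refine ⟨d, fun j => ?_, hpar⟩
  have hsum : (2 : ℚ) • s = ∑ j, (d j : ℚ) • b j := by
    ext i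
    have := congrArg (Int.cast : ℤ → ℚ) (congrFun hd i)
    simp only [Matrix.mulVec, dotProduct, Matrix.of_apply, Int.cast_sum, Int.cast_mul, hAb,
      Pi.smul_apply, smul_eq_mul, hts, Int.cast_ofNat] at this
    simp only [Pi.smul_apply, smul_eq_mul, Finset.sum_apply, ← this, mul_comm]
  have := congrArg (fun x => b.repr x j) hsum
  rw [b.repr_sum_self] at this
  simpa using this

/-- Carathéodory's theorem for cones. -/
theorem memQnnSpan.exists_linearIndepOn {n : ℕ} {S : Finset (Fin n → ℚ)} {v : Fin n → ℚ}
    (h : memQnnSpan S v) :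
    ∃ T ⊆ S, LinearIndepOn ℚ id (T : Set (Fin n → ℚ)) ∧ memQnnSpan T v := by
  induction S using Finset.strongInduction with
  | H S ih =>
  by_cases hS : LinearIndepOn ℚ id (S : Set (Fin n → ℚ))
  · exact ⟨S, subset_rfl, hS, h⟩
  obtain ⟨q, hq, rfl⟩ := h
  obtain ⟨g, hg, w, hw, hgw⟩ : ∃ g : (Fin n → ℚ) → ℚ, ∑ w ∈ S, g w • w = 0 ∧ ∃ w ∈ S, 0 < g w := by
    rw [linearIndepOn_finset_iff] at hS
    push Not at hS
    obtain ⟨g, hg, w, hw, hgw⟩ := hS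
    rcases hgw.lt_or_gt with hlt | hgt
    · exact ⟨-g, by simpa using hg, w, hw, by simpa using hlt⟩
    · exact ⟨g, hg, w, hw, hgt⟩
  obtain ⟨u, hu, hmin⟩ := (S.filter (0 < g ·)).exists_min_image (fun z => q z / g z)
    ⟨w, Finset.mem_filter.2 ⟨hw, hgw⟩⟩
  obtain ⟨huS, hgu⟩ := Finset.mem_filter.1 hu
  let k : (Fin n → ℚ) → ℚ := fun z => q z - q u / g u * g z
  have hk : ∀ z ∈ S, 0 ≤ k z := by
    intro z hz
    rw [sub_nonneg]
    rcases lt_or_ge 0 (g z) with hgz | hgz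
    · exact (le_div_iff₀ hgz).1 (hmin z (Finset.mem_filter.2 ⟨hz, hgz⟩))
    · exact (mul_nonpos_of_nonneg_of_nonpos (div_nonneg (hq u) hgu.le) hgz).trans (hq z)
  have hku : k u = 0 := by simp [k, hgu.ne']
  have hmem : memQnnSpan (S.erase u) (∑ w ∈ S, q w • w) := by
    refine ⟨fun z => max (k z) 0, fun z => le_max_right _ _, ?_⟩
    calc ∑ w ∈ S, q w • w = ∑ w ∈ S, k w • w := by
          simp only [k, sub_smul, mul_smul, Finset.sum_sub_distrib, ← Finset.smul_sum, hg,
            smul_zero, sub_zero]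
      _ = ∑ w ∈ S.erase u, k w • w := (Finset.sum_erase _ (by rw [hku, zero_smul])).symm
      _ = _ := Finset.sum_congr rfl fun z hz => by
          simp only [max_eq_left (hk z (Finset.mem_of_mem_erase hz))]
  obtain ⟨T, hT, hind, hv⟩ := ih _ (Finset.erase_ssubset huS) hmem
  exact ⟨T, hT.trans (Finset.erase_subset _ _), hind, hv⟩

theorem top_le_span_sign_vectors :
    ⊤ ≤ Submodule.span ℚ {w : Fin 4 → ℚ | ∀ i, w i = 1 ∨ w i = -1} := by
  rw [← (Pi.basisFun ℚ (Fin 4)).span_eq, Submodule.span_le]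
  rintro _ ⟨j, rfl⟩
  have h : Pi.basisFun ℚ (Fin 4) j =
      (1 / 2 : ℚ) • ((fun _ => 1) - fun i => if i = j then -1 else 1) := by
    ext i
    by_cases hij : i = j
    · subst hij
      simp
      norm_num
    · simp [hij]
  rw [h]
  refine Submodule.smul_mem _ _ (Submodule.sub_mem _ (Submodule.subset_span fun i => .inl rfl)
    (Submodule.subset_span fun i => ?_))
  by_cases hij : i = j <;> simp [hij]

/-- A vector in the cone of `S` has nonnegative coordinates in some basis of sign vectors in which
only basis vectors from `S` are needed to express the elements of `S`. -/
theorem memQnnSpan.exists_sign_basis {S : Finset (Fin 4 → ℚ)}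
    (hS : ∀ w ∈ S, ∀ i, w i = 1 ∨ w i = -1) {v : Fin 4 → ℚ} (hv : memQnnSpan S v) :
    ∃ b : Module.Basis (Fin 4) ℚ (Fin 4 → ℚ), (∀ j i, b j i = 1 ∨ b j i = -1) ∧
      (∀ s ∈ S, ∀ j, b.repr s j ≠ 0 → b j ∈ S) ∧ ∀ j, 0 ≤ b.repr v j := by
  obtain ⟨T, hTS, hT, q, hq, rfl⟩ := hv.exists_linearIndepOn
  have hTS' : (T : Set (Fin 4 → ℚ)) ⊆ S := Finset.coe_subset.2 hTS
  have hU := hT.linearIndepOn_extend hTS'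
  have hUS := hT.extend_subset hTS'
  have hTU := hT.subset_extend hTS'
  have hspan := hT.subset_span_extend hTS'
  generalize hT.extend hTS' = U at hU hUS hTU hspan
  have hUM : U ⊆ {w : Fin 4 → ℚ | ∀ i, w i = 1 ∨ w i = -1} := fun w hw => hS w (hUS hw)
  let b₀ := Module.Basis.extendLe hU hUM top_le_span_sign_vectors
  let b := b₀.reindex (b₀.indexEquiv (Pi.basisFun ℚ (Fin 4)))
  have hrange : Set.range b = Set.range b₀ := b₀.range_reindex _
  have hUb : U ⊆ Set.range b := hrange ▸ Module.Basis.subset_extendLe hU hUM _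
  refine ⟨b, fun j => ?_, fun s hs j hj => ?_, fun j => ?_⟩
  · have : b j ∈ Set.range b₀ := hrange ▸ Set.mem_range_self j
    exact Module.Basis.extendLe_subset hU hUM _ this
  · have hmem := hspan hs
    rw [← Set.image_preimage_eq_of_subset hUb, SetLike.mem_coe, b.mem_span_image] at hmem
    exact hUS (hmem (Finsupp.mem_support_iff.2 hj))
  · rw [map_sum, Finsupp.finsetSum_apply]
    refine Finset.sum_nonneg fun w hw => ?_
    obtain ⟨k, rfl⟩ := hUb (hTU hw)
    rw [map_smul, b.repr_self, Finsupp.smul_apply, smul_eq_mul, Finsupp.single_apply]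
    split <;> simp [hq]

theorem memNSpan.add {n : ℕ} {S : Finset (Fin n → ℚ)} {v w : Fin n → ℚ}
    (hv : memNSpan S v) (hw : memNSpan S w) : memNSpan S (v + w) := by
  obtain ⟨a, rfl⟩ := hv
  obtain ⟨c, rfl⟩ := hw
  exact ⟨a + c, by simp [add_smul, Finset.sum_add_distrib]⟩

theorem memNSpan_smul_of_mem {n : ℕ} {S : Finset (Fin n → ℚ)} {w : Fin n → ℚ} (hw : w ∈ S)
    (k : ℕ) : memNSpan S ((k : ℚ) • w) :=
  ⟨Pi.single w k, by
    rw [Finset.sum_eq_single_of_mem w hw fun u _ hu => by simp [hu]]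
    simp⟩

theorem memNSpan_of_repr {n : ℕ} {S : Finset (Fin n → ℚ)}
    (b : Module.Basis (Fin n) ℚ (Fin n → ℚ)) {v : Fin n → ℚ}
    (hv : ∀ j, 0 ≤ b.repr v j) (hint : ∀ j, ∃ z : ℤ, b.repr v j = z)
    (hS : ∀ j, b.repr v j ≠ 0 → b j ∈ S) : memNSpan S v := by
  rw [← b.sum_repr v]
  refine Finset.sum_induction _ (memNSpan S) (fun _ _ => memNSpan.add) ⟨0, by simp⟩ fun j _ => ?_
  by_cases hj : b.repr v j = 0
  · exact ⟨0, by simp [hj]⟩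
  · obtain ⟨z, hz⟩ := hint j
    have hz0 : 0 ≤ z := by
      have := hv j
      rw [hz] at this
      exact_mod_cast this
    lift z to ℕ using hz0
    rw [hz, Int.cast_natCast]
    exact memNSpan_smul_of_mem (hS j hj) z

/-- The set `M = {(ε1,ε2,ε3,ε4) ∈ ℚ^4 : εi ∈ {1,−1}}` of all 16 sign vectors in `ℚ^4` is
hereditarily normal: every subset of `M` is saturated. -/
theorem stmt13 :
    ∀ S : Finset (Fin 4 → ℚ), (∀ v ∈ S, ∀ i, v i = 1 ∨ v i = -1) →
      Saturated S := by
  intro S hS v hZ hQ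
  obtain ⟨b, hb, hbS, hnonneg⟩ := hQ.exists_sign_basis hS
  choose! d hd hpar using fun s (hs : s ∈ S) => exists_double_repr b hb s (hS s hs)
  obtain ⟨c, hc⟩ := hZ
  have hrepr : ∀ j, b.repr v j = ∑ w ∈ S, (c w : ℚ) * b.repr w j := fun j => by
    rw [hc, map_sum, Finsupp.finsetSum_apply]
    simp
  have hdouble : ∀ j, 2 * b.repr v j = ((∑ w ∈ S, c w * d w j : ℤ) : ℚ) := fun j => by
    rw [hrepr, Finset.mul_sum]
    push_cast
    exact Finset.sum_congr rfl fun w hw => by rw [← hd w hw j]; ring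
  have hsupp : ∀ j, b.repr v j ≠ 0 → b j ∈ S := by
    intro j hj
    rw [hrepr] at hj
    obtain ⟨w, hw, hne⟩ := Finset.exists_ne_zero_of_sum_ne_zero hj
    exact hbS w hw j (right_ne_zero_of_mul hne)
  by_cases heven : ∀ j, Even (∑ w ∈ S, c w * d w j)
  · refine memNSpan_of_repr b hnonneg (fun j => ?_) hsupp
    obtain ⟨z, hz⟩ := heven j
    refine ⟨z, ?_⟩
    have := hdouble j
    rw [hz] at this
    push_cast at this
    linarith
  · push Not at heven
    obtain ⟨j₀, hj₀⟩ := heven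
    have hodd : ∀ j, Odd (∑ w ∈ S, c w * d w j) := by
      intro j
      rw [← Int.not_even_iff_odd]
      refine fun hj => hj₀ ?_
      have hdiff : Even (∑ w ∈ S, c w * d w j₀ - ∑ w ∈ S, c w * d w j) := by
        rw [← Finset.sum_sub_distrib]
        refine Finset.even_sum _ fun w hw => ?_
        rw [← mul_sub]
        refine Even.mul_left ?_ _
        rcases hpar w hw with h | h
        · exact (h j₀).sub (h j)
        · rcases h j₀ with h₁ | h₁ <;> rcases h j with h₂ | h₂ <;> rw [h₁, h₂] <;> decide
      simpa using hdiff.add hj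
    obtain ⟨s, hs, hunit⟩ : ∃ s ∈ S, ∀ j, d s j = 1 ∨ d s j = -1 := by
      by_contra! hno
      refine hj₀ (Finset.even_sum _ fun w hw => Even.mul_left ?_ _)
      rcases hpar w hw with h | h
      · exact h j₀
      · obtain ⟨j, hj₁, hj₂⟩ := hno w hw
        exact ((h j).elim hj₁ hj₂).elim
    have hcoord : ∀ j, ∃ z : ℤ, 0 ≤ z ∧ b.repr (v - s) j = z := by
      intro j
      obtain ⟨m, hm⟩ := hodd j
      have h₁ := hdouble j
      have h₂ := hd s hs j
      have h₃ := hnonneg j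
      rw [hm] at h₁
      have hm0 : 0 ≤ 2 * m + 1 := by
        have : (0 : ℚ) ≤ ((2 * m + 1 : ℤ) : ℚ) := by linarith
        exact_mod_cast this
      rw [map_sub, Finsupp.sub_apply]
      push_cast at h₁
      rcases hunit j with h | h <;> rw [h] at h₂ <;> push_cast at h₂
      · exact ⟨m, by omega, by linarith⟩
      · exact ⟨m + 1, by omega, by push_cast; linarith⟩
    have hbmem : ∀ j, b j ∈ S := fun j => hbS s hs j fun h0 => by
      have := hd s hs j
      rw [h0] at this
      rcases hunit j with h | h <;> rw [h] at this <;> norm_num at this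
    have hsub : memNSpan S (v - s) := by
      refine memNSpan_of_repr b (fun j => ?_) (fun j => ?_) fun j _ => hbmem j
      · obtain ⟨z, hz, h⟩ := hcoord j
        rw [h]
        exact_mod_cast hz
      · obtain ⟨z, -, h⟩ := hcoord j
        exact ⟨z, h⟩
    have := hsub.add (memNSpan_smul_of_mem hs 1)
    rwa [Nat.cast_one, one_smul, sub_add_cancel] at this
end

section
/- The set M = {(ε1,…,ε5) ∈ ℚ^5 : εi ∈ {1, −1} for each i, and the number of indices i with εi = −1 is even} is hereditarily normal, i.e., every subset of M is saturated. -/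
open Submodule

/-- Bit `k` of `signMask i` tells whether the `i`-th coordinate of the `k`-th weight is `-1`. -/
def signMask : Fin 5 → ℕ := ![43690, 52428, 61680, 65280, 27030]

/-- The sixteen sign vectors of length five with an even number of negative entries. -/
def halfSpin (k : Fin 16) (i : Fin 5) : ℤ :=
  if (signMask i).testBit k then -1 else 1

/-- The vector with `i`-th and `j`-th entries twice those of the weight `u`, and zero elsewhere. -/
def pairVec (u : Fin 16) (i j l : Fin 5) : ℤ :=
  if l = i ∨ l = j then 2 * halfSpin u l else 0

section FiniteFacts

theorem halfSpin_eq_one_or (k : Fin 16) (i : Fin 5) : halfSpin k i = 1 ∨ halfSpin k i = -1 := by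
  unfold halfSpin
  split <;> simp

theorem exists_halfSpin_of_even : ∀ b : Fin 5 → Bool,
    Even (Finset.univ.filter fun i => b i = true).card →
      ∃ k, ∀ i, halfSpin k i = if b i then -1 else 1 := by
  decide +kernel

theorem exists_halfSpin_eq_or_neg : ∀ b : Fin 5 → Bool, ∃ k,
    (∀ i, (if b i then -1 else 1) = halfSpin k i) ∨
      ∀ i, (if b i then -1 else 1) = -halfSpin k i := by
  decide +kernel

theorem halfSpin_injective : Function.Injective halfSpin := by
  have h : ∀ a b, (∀ i, halfSpin a i = halfSpin b i) → a = b := by decide +kernel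
  exact fun a b hab => h a b (congrFun hab)

theorem dot_self : ∀ u, halfSpin u ⬝ᵥ halfSpin u = 5 := by
  decide +kernel

theorem dot_of_ne : ∀ u k, u ≠ k →
    halfSpin u ⬝ᵥ halfSpin k = 1 ∨ halfSpin u ⬝ᵥ halfSpin k = -3 := by
  decide +kernel

theorem card_dot_eq_neg_three : ∀ u,
    (Finset.univ.filter fun k => halfSpin u ⬝ᵥ halfSpin k = -3).card = 5 := by
  decide +kernel

theorem card_agree : ∀ i j, i ≠ j → ∀ u, (Finset.univ.filter fun k =>
    halfSpin k i = halfSpin u i ∧ halfSpin k j = halfSpin u j).card = 4 := by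
  decide +kernel

theorem add_of_dot_eq_neg_three : ∀ a b, halfSpin a ⬝ᵥ halfSpin b = -3 → ∀ i,
    halfSpin a i = halfSpin b i →
      ∀ l, halfSpin a l + halfSpin b l = if l = i then 2 * halfSpin a i else 0 := by
  decide +kernel

theorem exists_neg_eq_add_add : ∀ u s, ¬ (3 : ℤ) ∣ halfSpin u ⬝ᵥ halfSpin s → s ≠ u →
    ∃ k, halfSpin u ⬝ᵥ halfSpin k = -3 ∧ ∃ m, halfSpin u ⬝ᵥ halfSpin m = -3 ∧
      ∀ l, -halfSpin u l = halfSpin s l + halfSpin k l + halfSpin m l := by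
  decide +kernel

theorem sum_dot_eq_neg_three : ∀ u l,
    ∑ k with halfSpin u ⬝ᵥ halfSpin k = -3, halfSpin k l = -3 * halfSpin u l := by
  decide +kernel

theorem exists_pairVec_eq_of_opposite : ∀ i j, i ≠ j → ∀ s,
    ∃ k, (halfSpin k i = -halfSpin s i ∧ halfSpin k j = -halfSpin s j) ∧
    ∃ m, (k < m ∧ halfSpin m i = -halfSpin s i ∧ halfSpin m j = -halfSpin s j) ∧
    ∃ p, (m < p ∧ halfSpin p i = -halfSpin s i ∧ halfSpin p j = -halfSpin s j) ∧
      ∀ l, pairVec k i j l = halfSpin s l + halfSpin k l + halfSpin m l + halfSpin p l := by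
  decide +kernel

theorem exists_halfSpin_neg_except : ∀ j s, ∃ k, ∀ l,
    halfSpin k l = if l = j then halfSpin s l else -halfSpin s l := by
  decide +kernel

/-- A functional which vanishes modulo `4` on the weights agreeing with `u` at `i`, but not on
`pairVec u i j`. -/
def pairFunctional (u : Fin 16) (i j l : Fin 5) : ℤ :=
  if l = i then 0 else if l = j then halfSpin u i else 1

theorem four_dvd_pairFunctional : ∀ i j, i ≠ j → ∀ u k, halfSpin k i = halfSpin u i →
    (4 : ℤ) ∣ pairFunctional u i j ⬝ᵥ halfSpin k := by
  decide +kernel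

theorem not_four_dvd_pairFunctional : ∀ i j, i ≠ j → ∀ u,
    ¬ (4 : ℤ) ∣ pairFunctional u i j ⬝ᵥ pairVec u i j := by
  decide +kernel

end FiniteFacts

theorem halfSpin_eq_neg_of_ne {k u : Fin 16} {i : Fin 5} (h : halfSpin k i ≠ halfSpin u i) :
    halfSpin k i = -halfSpin u i := by
  rcases halfSpin_eq_one_or k i with h₁ | h₁ <;> rcases halfSpin_eq_one_or u i with h₂ | h₂ <;>
    simp_all

theorem pairVec_comm (u : Fin 16) (i j : Fin 5) : pairVec u i j = pairVec u j i := by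
  funext l
  simp [pairVec, or_comm]

theorem pairVec_congr {k u : Fin 16} {i j : Fin 5} (hi : halfSpin k i = halfSpin u i)
    (hj : halfSpin k j = halfSpin u j) : pairVec k i j = pairVec u i j := by
  funext l
  unfold pairVec
  split_ifs with h
  · rcases h with rfl | rfl <;> simp [*]
  · rfl

/-- A sign vector is a weight up to sign. -/
theorem exists_eq_mul_halfSpin {z : Fin 5 → ℤ} (hz : ∀ i, z i = 1 ∨ z i = -1) :
    ∃ σ : ℤ, (σ = 1 ∨ σ = -1) ∧ ∃ u, ∀ i, z i = σ * halfSpin u i := by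
  have hb : ∀ i, (if decide (z i = -1) then -1 else 1) = z i := by
    intro i
    rcases hz i with h | h <;> simp [h]
  obtain ⟨u, hu | hu⟩ := exists_halfSpin_eq_or_neg fun i => decide (z i = -1)
  · exact ⟨1, .inl rfl, u, fun i => by rw [← hb i, hu i, one_mul]⟩
  · exact ⟨-1, .inr rfl, u, fun i => by rw [← hb i, hu i, neg_one_mul]⟩

section Generation

variable {T : Finset (Fin 16)} {v : Fin 5 → ℤ}

theorem halfSpin_mem_span {R : Type*} [Semiring R] [Module R (Fin 5 → ℤ)] {k : Fin 16}
    (hk : k ∈ T) : halfSpin k ∈ span R (halfSpin '' (T : Set (Fin 16))) :=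
  subset_span ⟨k, hk, rfl⟩

/-- A lattice vector on which a functional does not vanish modulo `m` involves a weight with the
same property. -/
theorem exists_not_dvd_of_mem_span (hv : v ∈ span ℤ (halfSpin '' (T : Set (Fin 16))))
    (f : Fin 5 → ℤ) {m : ℤ} (hm : ¬ m ∣ f ⬝ᵥ v) : ∃ k ∈ T, ¬ m ∣ f ⬝ᵥ halfSpin k := by
  by_contra! h
  refine hm (span_induction ?_ ?_ ?_ ?_ hv)
  · rintro _ ⟨k, hk, rfl⟩
    exact h k hk
  · simp
  · intro x y _ _ hx hy
    rw [dotProduct_add]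
    exact dvd_add hx hy
  · intro a x _ hx
    rw [dotProduct_smul]
    exact hx.mul_left a

theorem even_sub_of_mem_span (hv : v ∈ span ℤ (halfSpin '' (T : Set (Fin 16)))) (i j : Fin 5) :
    Even (v i - v j) := by
  refine span_induction (p := fun v _ => Even (v i - v j)) ?_ ?_ ?_ ?_ hv
  · rintro _ ⟨k, -, rfl⟩
    rcases halfSpin_eq_one_or k i with h₁ | h₁ <;> rcases halfSpin_eq_one_or k j with h₂ | h₂ <;>
      simp [h₁, h₂]
  · simp
  · intro x y _ _ hx hy
    rw [Pi.add_apply, Pi.add_apply, add_sub_add_comm]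
    exact hx.add hy
  · intro a x _ hx
    rw [Pi.smul_apply, Pi.smul_apply, ← smul_sub]
    exact hx.mul_left a

theorem pairVec_mem_span_nat {u : Fin 16} {i j : Fin 5} (hij : i ≠ j)
    (hT : ∀ k, halfSpin k i = halfSpin u i → halfSpin k j = halfSpin u j → k ∈ T)
    (hv : pairVec u i j ∈ span ℤ (halfSpin '' (T : Set (Fin 16)))) :
    pairVec u i j ∈ span ℕ (halfSpin '' (T : Set (Fin 16))) := by
  obtain ⟨s, hsT, hs⟩ := exists_not_dvd_of_mem_span hv _ (not_four_dvd_pairFunctional i j hij u)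
  obtain ⟨t, htT, ht⟩ := exists_not_dvd_of_mem_span (pairVec_comm u i j ▸ hv) _
    (not_four_dvd_pairFunctional j i hij.symm u)
  replace hs := halfSpin_eq_neg_of_ne (mt (four_dvd_pairFunctional i j hij u s) hs)
  replace ht := halfSpin_eq_neg_of_ne (mt (four_dvd_pairFunctional j i hij.symm u t) ht)
  have opposite : ∀ r ∈ T, halfSpin r i = -halfSpin u i → halfSpin r j = -halfSpin u j →
      pairVec u i j ∈ span ℕ (halfSpin '' (T : Set (Fin 16))) := by
    intro r hr hri hrj
    obtain ⟨k, hk, m, hm, p, hp, h⟩ := exists_pairVec_eq_of_opposite i j hij r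
    simp only [hri, hrj, neg_neg] at hk hm hp
    rw [← pairVec_congr hk.1 hk.2, show pairVec k i j = _ from funext h]
    exact add_mem (add_mem (add_mem (halfSpin_mem_span hr) (halfSpin_mem_span (hT k hk.1 hk.2)))
      (halfSpin_mem_span (hT m hm.2.1 hm.2.2))) (halfSpin_mem_span (hT p hp.2.1 hp.2.2))
  by_cases hsj : halfSpin s j = halfSpin u j
  · by_cases hti : halfSpin t i = halfSpin u i
    · obtain ⟨k, hk⟩ := exists_halfSpin_neg_except j s
      obtain ⟨m, hm⟩ := exists_halfSpin_neg_except i t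
      have h : pairVec u i j = halfSpin s + halfSpin t + halfSpin k + halfSpin m := by
        funext l
        simp only [pairVec, Pi.add_apply, hk, hm]
        by_cases hli : l = i
        · subst hli
          simp only [hij, true_or, if_true, if_false]
          linarith
        · by_cases hlj : l = j
          · subst hlj
            simp only [hij.symm, or_true, if_true, if_false]
            linarith
          · simp [hli, hlj]
      rw [h]
      refine add_mem (add_mem (add_mem (halfSpin_mem_span hsT) (halfSpin_mem_span htT))
        (halfSpin_mem_span (hT k ?_ ?_))) (halfSpin_mem_span (hT m ?_ ?_))
      · rw [hk, if_neg hij, hs, neg_neg]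
      · rw [hk, if_pos rfl, hsj]
      · rw [hm, if_pos rfl, hti]
      · rw [hm, if_neg hij.symm, ht, neg_neg]
    · exact opposite t htT (halfSpin_eq_neg_of_ne hti) ht
  · exact opposite s hsT hs (halfSpin_eq_neg_of_ne hsj)

theorem neg_smul_mem_span_nat {u : Fin 16} {m : ℕ} (hm : ¬ 3 ∣ m)
    (hT : ∀ k, halfSpin u ⬝ᵥ halfSpin k = -3 → k ∈ T)
    (hv : m • -halfSpin u ∈ span ℤ (halfSpin '' (T : Set (Fin 16)))) :
    m • -halfSpin u ∈ span ℕ (halfSpin '' (T : Set (Fin 16))) := by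
  refine nsmul_mem ?_ m
  obtain ⟨s, hsT, hs⟩ := exists_not_dvd_of_mem_span hv (halfSpin u) (m := 3) (by
    rw [dotProduct_smul, dotProduct_neg, dot_self, nsmul_eq_mul]
    omega)
  rcases eq_or_ne s u with rfl | hsu
  · have h : -halfSpin s =
        ∑ k with halfSpin s ⬝ᵥ halfSpin k = -3, halfSpin k + 2 • halfSpin s := by
      funext l
      rw [Pi.add_apply, Finset.sum_apply, sum_dot_eq_neg_three]
      simp only [Pi.neg_apply, Pi.smul_apply, nsmul_eq_mul]
      push_cast
      ring
    rw [h]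
    exact add_mem (sum_mem fun k hk => halfSpin_mem_span (hT k (Finset.mem_filter.1 hk).2))
      (nsmul_mem (halfSpin_mem_span hsT) 2)
  · obtain ⟨k, hk, m, hm, h⟩ := exists_neg_eq_add_add u s hs hsu
    rw [show -halfSpin u = _ from funext h]
    exact add_mem (add_mem (halfSpin_mem_span hsT) (halfSpin_mem_span (hT k hk)))
      (halfSpin_mem_span (hT m hm))

end Generation

section Classification

variable {e : Fin 5 → Fin 16} {v : Fin 5 → ℤ}

theorem sum_mul_dot (n : Fin 5 → ℤ) (u : Fin 16) {x : Fin 5 → ℤ}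
    (hx : ∀ i, ∑ r, n r * halfSpin (e r) i = x i) :
    ∑ r, n r * (halfSpin u ⬝ᵥ halfSpin (e r)) = halfSpin u ⬝ᵥ x := by
  simp only [dotProduct, ← hx, Finset.mul_sum]
  rw [Finset.sum_comm]
  exact Finset.sum_congr rfl fun i _ => Finset.sum_congr rfl fun r _ => by ring

theorem abs_sum_mul_halfSpin_le (n : Fin 5 → ℤ) (i : Fin 5) :
    |∑ r, n r * halfSpin (e r) i| ≤ ∑ r, |n r| := by
  refine (Finset.abs_sum_le_sum_abs _ _).trans_eq (Finset.sum_congr rfl fun r _ => ?_)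
  rcases halfSpin_eq_one_or (e r) i with h | h <;> simp [h]

theorem sum_single_mul_halfSpin (r : Fin 5) (c : ℤ) (i : Fin 5) :
    ∑ s, Pi.single (M := fun _ => ℤ) r c s * halfSpin (e s) i = c * halfSpin (e r) i := by
  rw [Finset.sum_eq_single r (fun s _ hs => by simp [hs]) (by simp), Pi.single_eq_same]

/-- If the weights `e r` are linearly independent, coefficients can be compared. -/
theorem eq_of_sum_eq
    (hind : ∀ z : Fin 5 → ℤ, (∀ i, ∑ r, z r * halfSpin (e r) i = 0) → ∀ r, z r = 0)
    {n m : Fin 5 → ℤ}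
    (h : ∀ i, ∑ r, n r * halfSpin (e r) i = ∑ r, m r * halfSpin (e r) i) (r : Fin 5) :
    n r = m r := by
  refine sub_eq_zero.1 (hind (fun r => n r - m r) (fun i => ?_) r)
  simp only [sub_mul, Finset.sum_sub_distrib, h, sub_self]

theorem ne_of_sum_eq_mul
    (hind : ∀ z : Fin 5 → ℤ, (∀ i, ∑ r, z r * halfSpin (e r) i = 0) → ∀ r, z r = 0)
    {n : Fin 5 → ℤ} {u : Fin 16} {m : ℤ} (hm : ∀ r, n r ≠ m)
    (h : ∀ i, ∑ r, n r * halfSpin (e r) i = m * halfSpin u i) (r : Fin 5) : u ≠ e r := by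
  rintro rfl
  refine hm r ?_
  have := eq_of_sum_eq hind (m := Pi.single r m) (fun i => by
    rw [h, sum_single_mul_halfSpin]) r
  rwa [Pi.single_eq_same] at this

theorem exists_third (he : Function.Injective e)
    (hind : ∀ z : Fin 5 → ℤ, (∀ i, ∑ r, z r * halfSpin (e r) i = 0) → ∀ r, z r = 0)
    (hpar : ∀ i j, Even (v i - v j)) {n : Fin 5 → ℤ} (hn : ∀ r, 0 ≤ n r ∧ n r < 3)
    (hv : ∀ i, ∑ r, n r * halfSpin (e r) i = 3 * v i) :
    (∀ r, n r = 0) ∨ ∃ u, ∃ m : ℕ, ¬ 3 ∣ m ∧ v = m • -halfSpin u ∧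
      ∀ k, halfSpin u ⬝ᵥ halfSpin k = -3 → ∃ r, e r = k ∧ n r ≠ 0 := by
  obtain ⟨δ, hδ⟩ : ∃ δ : Fin 5 → ℤ, ∀ r, -1 ≤ n r - 3 * δ r ∧ n r - 3 * δ r ≤ 1 :=
    ⟨fun r => n r / 2, fun r => by have := hn r; dsimp only; omega⟩
  obtain ⟨ε, hε⟩ : ∃ ε : Fin 5 → ℤ, ∀ r, ε r = n r - 3 * δ r := ⟨_, fun _ => rfl⟩
  obtain ⟨z, hz⟩ : ∃ z : Fin 5 → ℤ, ∀ i, z i = v i - ∑ r, δ r * halfSpin (e r) i :=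
    ⟨_, fun _ => rfl⟩
  have hεz : ∀ i, ∑ r, ε r * halfSpin (e r) i = 3 * z i := by
    intro i
    simp only [hε, hz, sub_mul, Finset.sum_sub_distrib, hv, mul_assoc, ← Finset.mul_sum]
    ring
  have hz_par : ∀ i, Even (z i - z 0) := by
    intro i
    have h : z i - z 0 = (v i - v 0) -
        ∑ r, δ r * (halfSpin (e r) i - halfSpin (e r) 0) := by
      simp only [hz, mul_sub, Finset.sum_sub_distrib]
      ring
    rw [h]
    refine (hpar i 0).sub (Finset.even_sum _ fun r _ => Even.mul_left ?_ _)
    rcases halfSpin_eq_one_or (e r) i with h₁ | h₁ <;>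
      rcases halfSpin_eq_one_or (e r) 0 with h₂ | h₂ <;> simp [h₁, h₂]
  have hz_le : ∀ i, -1 ≤ z i ∧ z i ≤ 1 := by
    intro i
    have h₁ := abs_sum_mul_halfSpin_le (e := e) ε i
    have h₂ : ∑ r, |ε r| ≤ ∑ _r : Fin 5, (1 : ℤ) :=
      Finset.sum_le_sum fun r _ => abs_le.2 (by rw [hε]; exact hδ r)
    rw [hεz] at h₁
    have := abs_le.1 (h₁.trans h₂)
    simp at this
    omega
  rcases Int.even_or_odd (z 0) with h0 | h0
  · left
    have hz0 : ∀ i, z i = 0 := by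
      intro i
      obtain ⟨a, ha⟩ := hz_par i
      obtain ⟨b, hb⟩ := h0
      have := hz_le i
      omega
    intro r
    have := hind ε (fun i => by rw [hεz, hz0, mul_zero]) r
    have := hε r
    have := hn r
    omega
  · right
    obtain ⟨σ, hσ, u, hu⟩ := exists_eq_mul_halfSpin (z := z) fun i => by
      obtain ⟨a, ha⟩ := hz_par i
      obtain ⟨b, hb⟩ := h0
      have := hz_le i
      omega
    have hu_ne := ne_of_sum_eq_mul hind (n := ε) (u := u) (m := 3 * σ)
      (fun r => by have := hδ r; rw [hε]; omega)
      (fun i => by rw [hεz, hu, mul_assoc])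
    have hdot : ∑ r, (σ * ε r) * (halfSpin u ⬝ᵥ halfSpin (e r)) = 15 := by
      rw [sum_mul_dot (fun r => σ * ε r) u (x := 3 • halfSpin u)]
      · rw [dotProduct_smul, dot_self]
        rfl
      · intro i
        simp only [mul_assoc, ← Finset.mul_sum, hεz, hu, Pi.smul_apply]
        rcases hσ with rfl | rfl <;> simp
    have hterm : ∀ r, (σ * ε r) * (halfSpin u ⬝ᵥ halfSpin (e r)) ≤ 3 := by
      intro r
      have := hδ r
      rw [← hε] at this
      rcases dot_of_ne _ _ (hu_ne r) with h | h <;> rw [h] <;> rcases hσ with rfl | rfl <;> omega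
    have hterm_eq : ∀ r, (σ * ε r) * (halfSpin u ⬝ᵥ halfSpin (e r)) = 3 := by
      refine fun r => (Finset.sum_eq_sum_iff_of_le fun r _ => hterm r).1 ?_ r (Finset.mem_univ r)
      rw [hdot]
      simp
    have hall : ∀ r, ε r = -σ ∧ halfSpin u ⬝ᵥ halfSpin (e r) = -3 := by
      intro r
      have := hδ r
      rw [← hε] at this
      have h3 := hterm_eq r
      rcases dot_of_ne _ _ (hu_ne r) with h | h <;> rw [h] at h3 ⊢ <;>
        rcases hσ with rfl | rfl <;> omega
    have himage : Finset.univ.image e =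
        Finset.univ.filter fun k => halfSpin u ⬝ᵥ halfSpin k = -3 := by
      refine Finset.eq_of_subset_of_card_le ?_ ?_
      · intro k hk
        obtain ⟨r, -, rfl⟩ := Finset.mem_image.1 hk
        exact Finset.mem_filter.2 ⟨Finset.mem_univ _, (hall r).2⟩
      · rw [card_dot_eq_neg_three, Finset.card_image_of_injective _ he]
        simp
    obtain ⟨m, hm3, hm⟩ : ∃ m : ℕ, ¬ 3 ∣ m ∧ ∀ r, n r = m := by
      rcases hσ with rfl | rfl
      · refine ⟨2, by norm_num, fun r => ?_⟩
        have := hall r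
        have := hε r
        have := hn r
        push_cast
        omega
      · refine ⟨1, by norm_num, fun r => ?_⟩
        have := hall r
        have := hε r
        have := hn r
        push_cast
        omega
    refine ⟨u, m, hm3, ?_, fun k hk => ?_⟩
    · funext i
      have h := sum_dot_eq_neg_three u i
      rw [← himage, Finset.sum_image he.injOn] at h
      have h' := hv i
      simp only [hm, ← Finset.mul_sum, h] at h'
      simp only [Pi.smul_apply, Pi.neg_apply, nsmul_eq_mul]
      linarith
    · have : k ∈ Finset.univ.image e := by
        rw [himage]
        exact Finset.mem_filter.2 ⟨Finset.mem_univ _, hk⟩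
      obtain ⟨r, -, hr⟩ := Finset.mem_image.1 this
      refine ⟨r, hr, fun h0 => hm3 ?_⟩
      have := hm r
      omega

theorem exists_half (he : Function.Injective e)
    (hind : ∀ z : Fin 5 → ℤ, (∀ i, ∑ r, z r * halfSpin (e r) i = 0) → ∀ r, z r = 0)
    (hpar : ∀ i j, Even (v i - v j)) {n : Fin 5 → ℤ} (hn : ∀ r, 0 ≤ n r ∧ n r < 2)
    (hv : ∀ i, ∑ r, n r * halfSpin (e r) i = 2 * v i) :
    (∀ r, n r = 0) ∨ ∃ u i j, i ≠ j ∧ v = pairVec u i j ∧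
      ∀ k, halfSpin k i = halfSpin u i → halfSpin k j = halfSpin u j →
        ∃ r, e r = k ∧ n r ≠ 0 := by
  have hN : ∑ r, n r ≤ 5 :=
    (Finset.sum_le_sum fun r _ => show n r ≤ 1 by have := hn r; omega).trans (by simp)
  have hv_le : ∀ i, |2 * v i| ≤ ∑ r, n r := by
    intro i
    rw [← hv]
    refine (abs_sum_mul_halfSpin_le n i).trans_eq (Finset.sum_congr rfl fun r _ => ?_)
    exact abs_of_nonneg (hn r).1
  rcases Int.even_or_odd (v 0) with h0 | h0
  · obtain ⟨z, hz⟩ : ∃ z : Fin 5 → ℤ, ∀ i, v i = 2 * z i := by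
      refine ⟨fun i => v i / 2, fun i => ?_⟩
      obtain ⟨a, ha⟩ := hpar i 0
      obtain ⟨b, hb⟩ := h0
      dsimp only
      omega
    by_cases hz0 : ∀ i, z i = 0
    · exact .inl (hind n fun i => by rw [hv, hz, hz0, mul_zero, mul_zero])
    right
    push Not at hz0
    obtain ⟨i, hi⟩ := hz0
    have hz_le : ∀ l, -1 ≤ z l ∧ z l ≤ 1 := by
      intro l
      have := abs_le.1 (hv_le l)
      have := hz l
      omega
    have hN4 : ∑ r, n r = 4 := by
      have heven : Even (∑ r, n r - ∑ r, n r * halfSpin (e r) i) := by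
        rw [← Finset.sum_sub_distrib]
        refine Finset.even_sum _ fun r _ => ?_
        rcases halfSpin_eq_one_or (e r) i with h | h <;> simp [h]
      rw [hv, hz] at heven
      obtain ⟨a, ha⟩ := heven
      have := abs_le.1 (hv_le i)
      rw [hz] at this
      have := hz_le i
      omega
    have hagree : ∀ l, z l ≠ 0 → ∀ r, n r ≠ 0 → halfSpin (e r) l = z l := by
      intro l hl r hr
      have hsq : z l * z l = 1 := by
        have := hz_le l
        obtain h | h : z l = 1 ∨ z l = -1 := by omega
        all_goals rw [h]; rfl
      have hsum : ∑ r, n r * (1 - z l * halfSpin (e r) l) = 0 := by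
        have : ∑ r, n r * (1 - z l * halfSpin (e r) l) =
            ∑ r, n r - z l * ∑ r, n r * halfSpin (e r) l := by
          rw [Finset.mul_sum, ← Finset.sum_sub_distrib]
          exact Finset.sum_congr rfl fun r _ => by ring
        rw [this, hN4, hv, hz]
        linear_combination -4 * hsq
      have hzero := (Finset.sum_eq_zero_iff_of_nonneg fun r _ => mul_nonneg (hn r).1 (by
        have := hz_le l
        rcases halfSpin_eq_one_or (e r) l with h | h <;> rw [h] <;> omega)).1 hsum r
          (Finset.mem_univ r)
      have := (mul_eq_zero.1 hzero).resolve_left hr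
      linear_combination -(z l) * this - halfSpin (e r) l * hsq
    obtain ⟨r, hr⟩ : ∃ r, n r ≠ 0 := by
      by_contra! h
      simp [h] at hN4
    have hr1 : n r = 1 := by have := hn r; omega
    have hno : ∀ s, n s ≠ 0 → s ≠ r → halfSpin (e r) ⬝ᵥ halfSpin (e s) = 1 := by
      intro s hs hsr
      refine (dot_of_ne _ _ (he.ne hsr.symm)).resolve_right fun h3 => ?_
      have hadd := add_of_dot_eq_neg_three _ _ h3 i (by rw [hagree i hi r hr, hagree i hi s hs])
      have hz2 : ∀ l, 2 * z l = halfSpin (e r) l + halfSpin (e s) l := by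
        intro l
        rw [hadd l]
        split_ifs with hl
        · rw [hl, hagree i hi r hr]
        · by_contra hne
          have hl0 : z l ≠ 0 := fun h => hne (by rw [h, mul_zero])
          have := hadd l
          rw [if_neg hl, hagree l hl0 r hr, hagree l hl0 s hs] at this
          omega
      have := eq_of_sum_eq hind (n := n) (m := Pi.single r 2 + Pi.single s 2) (fun l => by
        simp only [Pi.add_apply, add_mul, Finset.sum_add_distrib, sum_single_mul_halfSpin]
        rw [hv, hz, hz2]
        ring) r
      rw [Pi.add_apply, Pi.single_eq_same, Pi.single_eq_of_ne hsr.symm] at this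
      omega
    have hdot : halfSpin (e r) ⬝ᵥ z = 2 := by
      have h := sum_mul_dot n (e r) (x := 4 • z) fun l => by
        rw [hv, hz, Pi.smul_apply, nsmul_eq_mul]
        push_cast
        ring
      rw [dotProduct_smul, nsmul_eq_mul] at h
      have h' : ∑ s, n s * (halfSpin (e r) ⬝ᵥ halfSpin (e s)) =
          ∑ s, (n s + Pi.single (M := fun _ => ℤ) r 4 s) := by
        refine Finset.sum_congr rfl fun s _ => ?_
        rcases eq_or_ne s r with rfl | hsr
        · rw [dot_self, hr1, Pi.single_eq_same]
          rfl
        · rw [Pi.single_eq_of_ne hsr, add_zero]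
          by_cases hs : n s = 0
          · rw [hs, zero_mul]
          · rw [hno s hs hsr, mul_one]
      rw [h', Finset.sum_add_distrib, hN4, Finset.sum_pi_single'] at h
      simp at h
      omega
    have hcard : (Finset.univ.filter fun l => z l ≠ 0).card = 2 := by
      have h : halfSpin (e r) ⬝ᵥ z = ∑ l, if z l ≠ 0 then (1 : ℤ) else 0 := by
        refine Finset.sum_congr rfl fun l _ => ?_
        split_ifs with hl
        · rw [← hagree l hl r hr]
          rcases halfSpin_eq_one_or (e r) l with h | h <;> rw [h] <;> rfl
        · rw [not_not.1 hl, mul_zero]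
      rw [hdot, ← Finset.sum_filter, Finset.sum_const, nsmul_eq_mul, mul_one] at h
      exact_mod_cast h.symm
    obtain ⟨a, b, hab, hsupp⟩ := Finset.card_eq_two.1 hcard
    have hmem : ∀ l, z l ≠ 0 ↔ l = a ∨ l = b := by
      intro l
      have := Finset.ext_iff.1 hsupp l
      simpa using this
    have ha := (hmem a).2 (.inl rfl)
    have hb := (hmem b).2 (.inr rfl)
    have himage : (Finset.univ.filter fun s => n s ≠ 0).image e = Finset.univ.filter fun k =>
        halfSpin k a = halfSpin (e r) a ∧ halfSpin k b = halfSpin (e r) b := by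
      refine Finset.eq_of_subset_of_card_le ?_ ?_
      · intro k hk
        obtain ⟨s, hs, rfl⟩ := Finset.mem_image.1 hk
        have hs := (Finset.mem_filter.1 hs).2
        refine Finset.mem_filter.2 ⟨Finset.mem_univ _, ?_, ?_⟩
        · rw [hagree a ha s hs, hagree a ha r hr]
        · rw [hagree b hb s hs, hagree b hb r hr]
      · rw [card_agree a b hab, Finset.card_image_of_injective _ he]
        have h : ∑ s, n s = ∑ s, if n s ≠ 0 then (1 : ℤ) else 0 := by
          refine Finset.sum_congr rfl fun s _ => ?_
          have := hn s
          split_ifs <;> omega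
        rw [hN4, ← Finset.sum_filter, Finset.sum_const, nsmul_eq_mul, mul_one] at h
        exact_mod_cast h.le
    refine ⟨e r, a, b, hab, ?_, fun k hka hkb => ?_⟩
    · funext l
      rw [hz, pairVec]
      split_ifs with hl
      · rw [hagree l ((hmem l).2 hl) r hr]
      · rw [not_not.1 (mt (hmem l).1 hl), mul_zero]
    · have : k ∈ (Finset.univ.filter fun s => n s ≠ 0).image e := by
        rw [himage]
        exact Finset.mem_filter.2 ⟨Finset.mem_univ _, hka, hkb⟩
      obtain ⟨s, hs, hsk⟩ := Finset.mem_image.1 this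
      exact ⟨s, hsk, (Finset.mem_filter.1 hs).2⟩
  · exfalso
    obtain ⟨σ, hσ, u, hu⟩ := exists_eq_mul_halfSpin (z := v) fun i => by
      obtain ⟨a, ha⟩ := hpar i 0
      obtain ⟨b, hb⟩ := h0
      have := abs_le.1 (hv_le i)
      omega
    have hu_ne := ne_of_sum_eq_mul hind (n := n) (u := u) (m := 2 * σ)
      (fun r => by have := hn r; omega) (fun i => by rw [hv, hu, mul_assoc])
    have hdot : ∑ r, n r * (halfSpin u ⬝ᵥ halfSpin (e r)) = 10 * σ := by
      rw [sum_mul_dot n u (x := (2 * σ) • halfSpin u)]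
      · rw [dotProduct_smul, dot_self, smul_eq_mul]
        ring
      · intro i
        rw [hv, hu, Pi.smul_apply, smul_eq_mul]
        ring
    obtain ⟨c, hc⟩ : ∃ c : Fin 5 → ℤ, ∀ r, 0 ≤ c r ∧ c r ≤ n r ∧
        n r * (halfSpin u ⬝ᵥ halfSpin (e r)) = n r - 4 * c r := by
      refine ⟨fun r => if halfSpin u ⬝ᵥ halfSpin (e r) = 1 then 0 else n r, fun r => ?_⟩
      have := hn r
      rcases dot_of_ne _ _ (hu_ne r) with h | h <;> simp [h] <;> omega
    have hc0 : 0 ≤ ∑ r, c r := Finset.sum_nonneg fun r _ => (hc r).1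
    have hcn : ∑ r, c r ≤ ∑ r, n r := Finset.sum_le_sum fun r _ => (hc r).2.1
    simp only [fun r => (hc r).2.2, Finset.sum_sub_distrib, ← Finset.mul_sum] at hdot
    omega

end Classification

section Determinant

/-- Hadamard's inequality for sign matrices of size five. -/
theorem det_sq_le_of_sign {X : Matrix (Fin 5) (Fin 5) ℤ} (hX : ∀ i j, X i j = 1 ∨ X i j = -1) :
    X.det ^ 2 ≤ 3125 := by
  have : Fact (Module.finrank ℝ (EuclideanSpace ℝ (Fin 5)) = 5) := ⟨by simp⟩
  let b := EuclideanSpace.basisFun (Fin 5) ℝ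
  let x : Fin 5 → EuclideanSpace ℝ (Fin 5) := fun i => WithLp.toLp 2 fun j => (X i j : ℝ)
  have hx : ∀ i, ‖x i‖ = √5 := by
    intro i
    rw [EuclideanSpace.norm_eq]
    congr 1
    have : ∀ j, ‖x i j‖ ^ 2 = 1 := by
      intro j
      change ‖(X i j : ℝ)‖ ^ 2 = 1
      rcases hX i j with h | h <;> simp [h]
    rw [Finset.sum_congr rfl fun j _ => this j]
    simp
  have hdet : b.toBasis.det x = (X.det : ℝ) := by
    rw [Module.Basis.det_apply, ← Matrix.det_transpose]
    exact (RingHom.map_det (Int.castRingHom ℝ) X).symm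
  have h := b.toBasis.orientation.abs_volumeForm_apply_le x
  rw [Orientation.volumeForm_robust _ b rfl, hdet] at h
  simp only [hx, Finset.prod_const, Finset.card_univ, Fintype.card_fin] at h
  have h2 : ((X.det : ℝ)) ^ 2 ≤ 3125 := by
    rw [← sq_abs]
    calc |(X.det : ℝ)| ^ 2 ≤ (√5 ^ 5) ^ 2 := by gcongr
      _ = (√5 ^ 2) ^ 5 := by ring
      _ = 3125 := by rw [Real.sq_sqrt (by norm_num)]; norm_num
  exact_mod_cast h2

/-- The rows form a basis of the lattice of integer vectors whose entries have equal parity. -/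
def parityMatrix : Matrix (Fin 5) (Fin 5) ℤ :=
  fun i j => if i = 0 then 1 else if i = j then 2 else 0

theorem det_parityMatrix : parityMatrix.det = 16 := by
  decide +kernel

theorem exists_vecMul_parityMatrix {v : Fin 5 → ℤ} (hv : ∀ i j, Even (v i - v j)) :
    ∃ y, Matrix.vecMul y parityMatrix = v := by
  choose y hy using fun i => hv i 0
  refine ⟨fun i => if i = 0 then v 0 else y i, funext fun j => ?_⟩
  have := hy j
  fin_cases j <;>
    simp [Matrix.vecMul, dotProduct, Fin.sum_univ_five, parityMatrix] at this ⊢ <;> linarith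

/-- Rational coefficients of a lattice vector with respect to independent weights have a common
denominator at most three. -/
theorem exists_denominator_le_three {e : Fin 5 → Fin 16} {v : Fin 5 → ℤ}
    (hind : ∀ z : Fin 5 → ℤ, (∀ i, ∑ r, z r * halfSpin (e r) i = 0) → ∀ r, z r = 0)
    (hpar : ∀ i j, Even (v i - v j)) {q : Fin 5 → ℚ}
    (hq : ∀ i, ∑ r, q r * (halfSpin (e r) i : ℚ) = v i) :
    ∃ D : ℤ, 1 ≤ D ∧ D ≤ 3 ∧ ∃ m : Fin 5 → ℤ, ∀ r, (D : ℚ) * q r = m r := by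
  let X : Matrix (Fin 5) (Fin 5) ℤ := fun r => halfSpin (e r)
  have hXpar : ∀ r i j, Even (X r i - X r j) := by
    intro r i j
    rcases halfSpin_eq_one_or (e r) i with h₁ | h₁ <;>
      rcases halfSpin_eq_one_or (e r) j with h₂ | h₂ <;> simp [X, h₁, h₂]
  choose Y hY using fun r => exists_vecMul_parityMatrix (hXpar r)
  obtain ⟨y, hy⟩ := exists_vecMul_parityMatrix hpar
  have hYX : Matrix.of Y * parityMatrix = X := by
    ext r i
    rw [← hY r]
    rfl
  have hdet : X.det = (Matrix.of Y).det * 16 := by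
    rw [← hYX, Matrix.det_mul, det_parityMatrix]
  have hX0 : X.det ≠ 0 := by
    intro h0
    obtain ⟨z, hz0, hz⟩ := Matrix.exists_vecMul_eq_zero_iff.2 h0
    exact hz0 (funext (hind z fun i => congrFun hz i))
  have hle : X.det ^ 2 ≤ 3125 := det_sq_le_of_sign fun r i => halfSpin_eq_one_or (e r) i
  obtain ⟨d, hd⟩ : ∃ d, d = (Matrix.of Y).det := ⟨_, rfl⟩
  rw [hdet, ← hd] at hX0 hle
  let f := Int.castRingHom ℚ
  let YQ : Matrix (Fin 5) (Fin 5) ℚ := (Matrix.of Y).map f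
  let PQ : Matrix (Fin 5) (Fin 5) ℚ := parityMatrix.map f
  have hPQ : PQ.det ≠ 0 := by
    have : PQ.det = f parityMatrix.det := (RingHom.map_det f parityMatrix).symm
    rw [this, det_parityMatrix]
    norm_num
  have hqY : Matrix.vecMul q YQ = f ∘ y := by
    have h : Matrix.vecMul (Matrix.vecMul q YQ) PQ = Matrix.vecMul (f ∘ y) PQ := by
      rw [Matrix.vecMul_vecMul, ← Matrix.map_mul, hYX]
      funext i
      rw [← RingHom.map_vecMul, hy]
      exact hq i
    exact Matrix.vecMul_injective_of_isUnit ((Matrix.isUnit_iff_isUnit_det _).2 hPQ.isUnit) h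
  have hdq : ∀ r, (d : ℚ) * q r = (Matrix.vecMul y (Matrix.of Y).adjugate r : ℤ) := by
    intro r
    have h : Matrix.vecMul (Matrix.vecMul q YQ) YQ.adjugate = YQ.det • q := by
      rw [Matrix.vecMul_vecMul, Matrix.mul_adjugate, Matrix.vecMul_smul, Matrix.vecMul_one]
    rw [hqY] at h
    have hdetY : YQ.det = (d : ℚ) := by
      rw [hd]
      exact (RingHom.map_det f _).symm
    have hadj : YQ.adjugate = (Matrix.of Y).adjugate.map f := (RingHom.map_adjugate f _).symm
    rw [hdetY, hadj] at h
    have h' := congrFun h r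
    rw [← RingHom.map_vecMul] at h'
    exact h'.symm
  have hd3 : -3 ≤ d ∧ d ≤ 3 := by
    constructor <;> nlinarith
  rcases lt_or_gt_of_ne (show d ≠ 0 by rintro rfl; simp at hX0) with hneg | hpos
  · refine ⟨-d, by omega, by omega, fun r => -Matrix.vecMul y (Matrix.of Y).adjugate r, ?_⟩
    intro r
    push_cast
    rw [neg_mul, hdq]
  · exact ⟨d, by omega, by omega, _, hdq⟩

end Determinant

/-- Conic version of Carathéodory's theorem. -/
theorem exists_linearIndepOn_sum_smul_eq {K ι E : Type*} [Field K] [LinearOrder K]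
    [IsStrictOrderedRing K] [AddCommGroup E] [Module K E] (w : ι → E)
    (s : Finset ι) (q : ι → K) (hq : ∀ i ∈ s, 0 ≤ q i) :
    ∃ t ⊆ s, LinearIndepOn K w (t : Set ι) ∧ ∃ p : ι → K, (∀ i ∈ t, 0 ≤ p i) ∧
      ∑ i ∈ t, p i • w i = ∑ i ∈ s, q i • w i := by
  classical
  induction s using Finset.strongInduction generalizing q with
  | H s ih =>
    by_cases hs : LinearIndepOn K w (s : Set ι)
    · exact ⟨s, subset_rfl, hs, q, hq, rfl⟩
    obtain ⟨g, hg, hpos⟩ : ∃ g : ι → K, ∑ i ∈ s, g i • w i = 0 ∧ ∃ i ∈ s, 0 < g i := by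
      rw [linearIndepOn_finset_iff] at hs
      push Not at hs
      obtain ⟨g, hg, i, hi, hgi⟩ := hs
      rcases lt_or_gt_of_ne hgi with h | h
      · exact ⟨-g, by simp [hg], i, hi, by simpa using h⟩
      · exact ⟨g, hg, i, hi, h⟩
    obtain ⟨i₀, hi₀, hmin⟩ := Finset.exists_min_image (s.filter fun i => 0 < g i)
      (fun i => q i / g i) (by
        obtain ⟨i, hi, h⟩ := hpos
        exact ⟨i, Finset.mem_filter.2 ⟨hi, h⟩⟩)
    obtain ⟨hi₀s, hgi₀⟩ := Finset.mem_filter.1 hi₀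
    set c := q i₀ / g i₀ with hc
    have hc0 : 0 ≤ c := div_nonneg (hq _ hi₀s) hgi₀.le
    obtain ⟨t, hts, ht, p, hp, hpt⟩ := ih _ (Finset.erase_ssubset hi₀s)
      (fun i => q i - c * g i) (fun i hi => by
        have his := Finset.mem_of_mem_erase hi
        rcases le_or_gt (g i) 0 with h | h
        · have := hq i his
          have := mul_nonpos_of_nonneg_of_nonpos hc0 h
          linarith
        · have := hmin i (Finset.mem_filter.2 ⟨his, h⟩)
          rw [le_div_iff₀ h] at this
          linarith)
    refine ⟨t, hts.trans (Finset.erase_subset _ _), ht, p, hp, hpt.trans ?_⟩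
    have h0 : (q i₀ - c * g i₀) • w i₀ = 0 := by
      rw [hc, div_mul_cancel₀ _ hgi₀.ne', sub_self, zero_smul]
    rw [Finset.sum_erase (f := fun i => (q i - c * g i) • w i) _ h0]
    simp only [sub_smul, mul_smul, Finset.sum_sub_distrib, ← Finset.smul_sum, hg, smul_zero,
      sub_zero]

section Extension

/-- The weights as rational vectors. -/
def ratHalfSpin (k : Fin 16) (i : Fin 5) : ℚ := halfSpin k i

theorem exists_add_eq_single : ∀ i, ∃ a b, ∀ l,
    halfSpin a l + halfSpin b l = if l = i then 2 else 0 := by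
  decide +kernel

theorem span_range_ratHalfSpin : span ℚ (Set.range ratHalfSpin) = ⊤ := by
  rw [eq_top_iff, ← (Pi.basisFun ℚ (Fin 5)).span_eq, span_le]
  rintro _ ⟨i, rfl⟩
  obtain ⟨a, b, hab⟩ := exists_add_eq_single i
  have h : Pi.basisFun ℚ (Fin 5) i = (1 / 2 : ℚ) • (ratHalfSpin a + ratHalfSpin b) := by
    funext l
    have := hab l
    simp only [Pi.basisFun_apply, Pi.smul_apply, Pi.add_apply, ratHalfSpin, smul_eq_mul,
      Pi.single_apply]
    rw [← Int.cast_add, this]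
    split_ifs <;> norm_num
  rw [h]
  exact smul_mem _ _ (add_mem (subset_span ⟨a, rfl⟩) (subset_span ⟨b, rfl⟩))

/-- Independent weights are part of a basis consisting of weights. -/
theorem exists_basis_extension {J : Finset (Fin 16)}
    (hJ : LinearIndepOn ℚ ratHalfSpin (J : Set (Fin 16))) :
    ∃ e : Fin 5 → Fin 16, Function.Injective e ∧ LinearIndependent ℚ (ratHalfSpin ∘ e) ∧
      ∀ k ∈ J, ∃ r, e r = k := by
  let I := hJ.extend (Set.subset_univ _)
  have hI : LinearIndependent ℚ fun k : I => ratHalfSpin k := hJ.linearIndepOn_extend _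
  have hspan : ⊤ ≤ span ℚ (Set.range fun k : I => ratHalfSpin k) := by
    rw [← span_range_ratHalfSpin, span_le, ← Set.image_univ]
    refine (hJ.image_subset_span_image_extend (Set.subset_univ _)).trans_eq ?_
    rw [Set.image_eq_range]
  have hcard : Nat.card I = 5 := by
    rw [← Module.finrank_eq_nat_card_basis (Module.Basis.mk hI hspan)]
    simp
  let E : Fin 5 ≃ I := (Finite.equivFinOfCardEq hcard).symm
  refine ⟨fun r => E r, Subtype.val_injective.comp E.injective, hI.comp E E.injective, ?_⟩
  intro k hk
  exact ⟨E.symm ⟨k, hJ.subset_extend _ hk⟩, by simp⟩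

end Extension

/-- The sixteen weights are hereditarily normal, in integral form. -/
theorem mem_span_nat_of_nonneg {T : Finset (Fin 16)} {v : Fin 5 → ℤ}
    (hv : v ∈ span ℤ (halfSpin '' (T : Set (Fin 16)))) {q : Fin 16 → ℚ} (hq : ∀ k ∈ T, 0 ≤ q k)
    (hqv : ∀ i, ∑ k ∈ T, q k * (halfSpin k i : ℚ) = v i) :
    v ∈ span ℕ (halfSpin '' (T : Set (Fin 16))) := by
  obtain ⟨t, htT, ht, p, hp, hpq⟩ := exists_linearIndepOn_sum_smul_eq ratHalfSpin T q hq
  obtain ⟨e, he, heind, hte⟩ := exists_basis_extension ht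
  have hind : ∀ z : Fin 5 → ℤ, (∀ i, ∑ r, z r * halfSpin (e r) i = 0) → ∀ r, z r = 0 := by
    intro z hz r
    have := Fintype.linearIndependent_iff.1 heind (fun r => (z r : ℚ)) (by
      funext i
      simp only [Finset.sum_apply, Pi.smul_apply, Function.comp_apply, ratHalfSpin, smul_eq_mul,
        Pi.zero_apply]
      exact_mod_cast hz i) r
    exact_mod_cast this
  let c : Fin 5 → ℚ := fun r => if e r ∈ t then p (e r) else 0
  have hc0 : ∀ r, 0 ≤ c r := by
    intro r
    simp only [c]
    split_ifs with h
    exacts [hp _ h, le_rfl]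
  have hcT : ∀ r, c r ≠ 0 → e r ∈ T := fun r h => htT (by
    by_contra hr
    exact h (if_neg hr))
  have hcv : ∀ i, ∑ r, c r * (halfSpin (e r) i : ℚ) = v i := by
    intro i
    have h := congrFun hpq i
    simp only [Finset.sum_apply, Pi.smul_apply, ratHalfSpin, smul_eq_mul, hqv] at h
    have hsub : t ⊆ Finset.univ.image e := fun k hk => by
      obtain ⟨r, hr⟩ := hte k hk
      exact Finset.mem_image.2 ⟨r, Finset.mem_univ r, hr⟩
    rw [← h, ← Finset.sum_image (f := fun k => (if k ∈ t then p k else 0) * (halfSpin k i : ℚ))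
      he.injOn, ← Finset.sum_subset hsub fun k _ hk => by rw [if_neg hk, zero_mul]]
    exact Finset.sum_congr rfl fun k hk => by rw [if_pos hk]
  have hpar := even_sub_of_mem_span hv
  obtain ⟨D, hD1, hD3, m, hm⟩ := exists_denominator_le_three hind hpar hcv
  have hDQ : (0 : ℚ) < D := by exact_mod_cast hD1
  obtain ⟨n, hn⟩ : ∃ n : Fin 5 → ℤ, ∀ r, n r = m r - D * ⌊c r⌋ := ⟨_, fun _ => rfl⟩
  have hn_fract : ∀ r, (n r : ℚ) = D * Int.fract (c r) := by
    intro r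
    rw [hn, Int.fract, mul_sub, hm]
    push_cast
    rfl
  have hn_lt : ∀ r, 0 ≤ n r ∧ n r < D := by
    intro r
    have h₁ : (0 : ℚ) ≤ n r := by
      rw [hn_fract]
      exact mul_nonneg hDQ.le (Int.fract_nonneg _)
    have h₂ : (n r : ℚ) < D := by
      rw [hn_fract]
      exact mul_lt_of_lt_one_right hDQ (Int.fract_lt_one _)
    exact ⟨by exact_mod_cast h₁, by exact_mod_cast h₂⟩
  have hnT : ∀ r, n r ≠ 0 → e r ∈ T := fun r h => hcT r fun h0 => h (by
    have := hn_fract r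
    rw [h0, Int.fract_zero, mul_zero] at this
    exact_mod_cast this)
  have hfloor : ∑ r, ⌊c r⌋ • halfSpin (e r) ∈ span ℕ (halfSpin '' (T : Set (Fin 16))) := by
    refine sum_mem fun r _ => ?_
    rw [← Int.toNat_of_nonneg (Int.floor_nonneg.2 (hc0 r)), natCast_zsmul]
    by_cases h : c r = 0
    · simp [h]
    · exact nsmul_mem (halfSpin_mem_span (hcT r h)) _
  obtain ⟨v', hv'⟩ : ∃ v', v' = v - ∑ r, ⌊c r⌋ • halfSpin (e r) := ⟨_, rfl⟩
  have hv'_mem : v' ∈ span ℤ (halfSpin '' (T : Set (Fin 16))) := by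
    rw [hv']
    refine sub_mem hv (sum_mem fun r _ => ?_)
    by_cases h : c r = 0
    · simp [h]
    · exact zsmul_mem (halfSpin_mem_span (hcT r h)) _
  have hnv' : ∀ i, ∑ r, n r * halfSpin (e r) i = D * v' i := by
    intro i
    have h : ((∑ r, n r * halfSpin (e r) i : ℤ) : ℚ) = (D * v' i : ℤ) := by
      rw [hv']
      simp only [Pi.sub_apply, Finset.sum_apply, Pi.smul_apply, smul_eq_mul]
      push_cast
      rw [← hcv, ← Finset.sum_sub_distrib, Finset.mul_sum]
      refine Finset.sum_congr rfl fun r _ => ?_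
      rw [hn_fract, Int.fract]
      ring
    exact_mod_cast h
  suffices h : v' ∈ span ℕ (halfSpin '' (T : Set (Fin 16))) by
    rw [← sub_add_cancel v (∑ r, ⌊c r⌋ • halfSpin (e r)), ← hv']
    exact add_mem h hfloor
  have hpar' := even_sub_of_mem_span hv'_mem
  have of_zero : (∀ r, n r = 0) → v' ∈ span ℕ (halfSpin '' (T : Set (Fin 16))) := by
    intro h
    have : v' = 0 := funext fun i => by
      have := hnv' i
      simp only [h, zero_mul, Finset.sum_const_zero] at this
      exact (mul_eq_zero.1 this.symm).resolve_left (by omega)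
    rw [this]
    exact zero_mem _
  obtain rfl | rfl | rfl : D = 1 ∨ D = 2 ∨ D = 3 := by omega
  · exact of_zero fun r => by have := hn_lt r; omega
  · obtain h | ⟨u, i, j, hij, hu, h⟩ := exists_half he hind hpar' hn_lt hnv'
    · exact of_zero h
    · rw [hu] at hv'_mem ⊢
      refine pairVec_mem_span_nat hij (fun k hki hkj => ?_) hv'_mem
      obtain ⟨r, rfl, hr⟩ := h k hki hkj
      exact hnT r hr
  · obtain h | ⟨u, m, hm3, hu, h⟩ := exists_third he hind hpar' hn_lt hnv'
    · exact of_zero h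
    · rw [hu] at hv'_mem ⊢
      refine neg_smul_mem_span_nat hm3 (fun k hk => ?_) hv'_mem
      obtain ⟨r, rfl, hr⟩ := h k hk
      exact hnT r hr

theorem ratHalfSpin_injective : Function.Injective ratHalfSpin := fun _ _ hab =>
  halfSpin_injective (funext fun i => Int.cast_injective (congrFun hab i))

theorem exists_ratHalfSpin_eq {v : Fin 5 → ℚ} (hv : ∀ i, v i = 1 ∨ v i = -1)
    (heven : Even (Finset.univ.filter fun i => v i = -1).card) : ∃ k, ratHalfSpin k = v := by
  obtain ⟨k, hk⟩ := exists_halfSpin_of_even (fun i => decide (v i = -1)) (by simpa using heven)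
  refine ⟨k, funext fun i => ?_⟩
  rw [ratHalfSpin, hk]
  rcases hv i with h | h <;> norm_num [h]

/-- The set `M = {(ε1,…,ε5) ∈ ℚ^5 : εi ∈ {1,−1}, the number of i with εi = −1 is even}` is
hereditarily normal: every subset of `M` is saturated. -/
theorem stmt14 :
    ∀ S : Finset (Fin 5 → ℚ),
      (∀ v ∈ S, (∀ i, v i = 1 ∨ v i = -1) ∧
        Even (Finset.univ.filter (fun i => v i = -1)).card) →
      Saturated S := by
  rintro S hS v ⟨c, hc⟩ ⟨q, hq, hqv⟩
  obtain ⟨T, rfl⟩ : ∃ T : Finset (Fin 16), S = T.image ratHalfSpin := by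
    refine ⟨Finset.univ.filter fun k => ratHalfSpin k ∈ S, Finset.ext fun w => ?_⟩
    simp only [Finset.mem_image, Finset.mem_filter, Finset.mem_univ, true_and]
    constructor
    · intro hw
      obtain ⟨k, rfl⟩ := exists_ratHalfSpin_eq (hS w hw).1 (hS w hw).2
      exact ⟨k, hw, rfl⟩
    · rintro ⟨k, hk, rfl⟩
      exact hk
  rw [Finset.sum_image ratHalfSpin_injective.injOn] at hc hqv
  have hz : ∀ i, ∑ k ∈ T, q (ratHalfSpin k) * (halfSpin k i : ℚ) =
      ((∑ k ∈ T, c (ratHalfSpin k) • halfSpin k) i : ℤ) := by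
    intro i
    have h := congrFun (hqv.symm.trans hc) i
    simp only [Finset.sum_apply, Pi.smul_apply, smul_eq_mul] at h ⊢
    push_cast
    exact h
  obtain ⟨a, ha⟩ := (mem_span_image_finset_iff_exists_fun' ℕ).1 (mem_span_nat_of_nonneg
    (sum_mem fun k hk => zsmul_mem (halfSpin_mem_span hk) _) (fun k _ => hq (ratHalfSpin k)) hz)
  refine ⟨fun w => a (Function.invFun ratHalfSpin w), ?_⟩
  rw [Finset.sum_image ratHalfSpin_injective.injOn, hc]
  simp only [Function.leftInverse_invFun ratHalfSpin_injective _]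
  funext i
  have h := congrArg (Int.cast (R := ℚ)) (congrFun ha i)
  simp only [Finset.sum_apply, Pi.smul_apply, smul_eq_mul] at h ⊢
  simp only [nsmul_eq_mul] at h
  push_cast at h
  exact h.symm
end

section
/- The set M = {(ε1,…,ε6) ∈ ℚ^6 : εi ∈ {1, −1} for each i, and the number of indices i with εi = −1 is even} is hereditarily normal, i.e., every subset of M is saturated. -/
theorem memNSpan_of_mem_closure {n : ℕ} {S : Finset (Fin n → ℚ)} {v : Fin n → ℚ}
    (h : v ∈ AddSubmonoid.closure (S : Set (Fin n → ℚ))) : memNSpan S v := by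
  classical
  induction h using AddSubmonoid.closure_induction with
  | mem x hx =>
    refine ⟨Pi.single x 1, ?_⟩
    rw [Finset.sum_eq_single_of_mem x hx fun w _ hw => by simp [hw]]
    simp
  | zero => exact ⟨0, by simp⟩
  | add x y _ _ hx hy =>
    obtain ⟨a, rfl⟩ := hx
    obtain ⟨a', rfl⟩ := hy
    exact ⟨a + a', by simp [add_smul, Finset.sum_add_distrib]⟩

/-- Hadamard's inequality for the rows of a real matrix. -/
theorem Matrix.sq_det_le_prod_row {n : ℕ} (B : Matrix (Fin n) (Fin n) ℝ) :
    B.det ^ 2 ≤ ∏ i, ∑ j, B i j ^ 2 := by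
  have : Fact (Module.finrank ℝ (EuclideanSpace ℝ (Fin n)) = n) := ⟨by simp⟩
  let b := EuclideanSpace.basisFun (Fin n) ℝ
  let v : Fin n → EuclideanSpace ℝ (Fin n) := fun i => WithLp.toLp 2 (B i)
  have hdet : b.toBasis.det v = B.det := by
    rw [Module.Basis.det_apply, ← Matrix.det_transpose]
    congr 1
  have h := b.toBasis.orientation.abs_volumeForm_apply_le v
  rw [Orientation.volumeForm_robust' _ b, hdet] at h
  calc B.det ^ 2 = |B.det| ^ 2 := (sq_abs _).symm
    _ ≤ (∏ i, ‖v i‖) ^ 2 := by gcongr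
    _ = ∏ i, ∑ j, B i j ^ 2 := by
      rw [← Finset.prod_pow]
      refine Finset.prod_congr rfl fun i _ => ?_
      rw [EuclideanSpace.norm_sq_eq]
      simp [v]

/-- Integral form of the weights of the half-spin module, scaled by `2`. -/
def IsHalfSpinWeight (z : Fin 6 → ℤ) : Prop :=
  (∀ i, z i = 1 ∨ z i = -1) ∧ (∑ i, z i) % 4 = 2

namespace IsHalfSpinWeight

theorem dotProduct_self {z : Fin 6 → ℤ} (hz : IsHalfSpinWeight z) : z ⬝ᵥ z = 6 := by
  have : ∀ i, z i * z i = 1 := fun i => by rcases hz.1 i with h | h <;> simp [h]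
  simp [dotProduct, this]

theorem dotProduct_emod_four {z w : Fin 6 → ℤ} (hz : IsHalfSpinWeight z)
    (hw : IsHalfSpinWeight w) : (z ⬝ᵥ w) % 4 = 2 := by
  have h : ∀ i, ∃ k, z i * w i = z i + w i - 1 + 4 * k := fun i => by
    rcases hz.1 i with h | h <;> rcases hw.1 i with h' | h' <;> rw [h, h']
    exacts [⟨0, by norm_num⟩, ⟨0, by norm_num⟩, ⟨0, by norm_num⟩, ⟨1, by norm_num⟩]
  choose k hk using h
  have : z ⬝ᵥ w = ∑ i, z i + ∑ i, w i - 6 + 4 * ∑ i, k i := by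
    simp [dotProduct, hk, Finset.sum_add_distrib, Finset.mul_sum]
  have h₁ := hz.2
  have h₂ := hw.2
  omega

theorem four_le_sq_dotProduct {z w : Fin 6 → ℤ} (hz : IsHalfSpinWeight z)
    (hw : IsHalfSpinWeight w) : 4 ≤ (z ⬝ᵥ w) ^ 2 := by
  have h := hz.dotProduct_emod_four hw
  rcases le_or_gt 0 (z ⬝ᵥ w) with h' | h'
  · nlinarith [show 2 ≤ z ⬝ᵥ w by omega]
  · nlinarith [show z ⬝ᵥ w ≤ -2 by omega]

theorem norm_add_mul_norm_sub_le {z w : Fin 6 → ℤ} (hz : IsHalfSpinWeight z)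
    (hw : IsHalfSpinWeight w) :
    (∑ j, (z j + w j) ^ 2) * ∑ j, (z j - w j) ^ 2 ≤ 128 := by
  have h₁ : ∑ j, (z j + w j) ^ 2 = z ⬝ᵥ z + w ⬝ᵥ w + 2 * z ⬝ᵥ w := by
    simp only [dotProduct, Finset.mul_sum, ← Finset.sum_add_distrib]
    exact Finset.sum_congr rfl fun _ _ => by ring
  have h₂ : ∑ j, (z j - w j) ^ 2 = z ⬝ᵥ z + w ⬝ᵥ w - 2 * z ⬝ᵥ w := by
    simp only [dotProduct, Finset.mul_sum, ← Finset.sum_add_distrib, ← Finset.sum_sub_distrib]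
    exact Finset.sum_congr rfl fun _ _ => by ring
  rw [h₁, h₂, hz.dotProduct_self, hw.dotProduct_self]
  linarith [hz.four_le_sq_dotProduct hw]

/-- The determinant bound comes from Hadamard's inequality for the matrix whose rows are the sums
and differences of consecutive rows. -/
theorem sq_det_le {Z : Matrix (Fin 6) (Fin 6) ℤ} (hZ : ∀ i, IsHalfSpinWeight (Z i)) :
    Z.det ^ 2 ≤ 2 ^ 15 := by
  let P : Matrix (Fin 6) (Fin 6) ℤ :=
    !![1, 1, 0, 0, 0, 0; 1, -1, 0, 0, 0, 0; 0, 0, 1, 1, 0, 0; 0, 0, 1, -1, 0, 0;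
      0, 0, 0, 0, 1, 1; 0, 0, 0, 0, 1, -1]
  have hP : P.det ^ 2 = 64 := by
    have : P * P.transpose = (2 : ℤ) • 1 := by decide
    calc P.det ^ 2 = (P * P.transpose).det := by rw [Matrix.det_mul, Matrix.det_transpose, sq]
      _ = 64 := by rw [this, Matrix.det_smul]; simp
  have hH : (P * Z).det ^ 2 ≤ ∏ i, ∑ j, (P * Z) i j ^ 2 := by
    have h := Matrix.sq_det_le_prod_row ((P * Z).map (Int.castRingHom ℝ))
    rw [← RingHom.mapMatrix_apply, ← RingHom.map_det] at h
    simp only [RingHom.mapMatrix_apply, Matrix.map_apply, Int.coe_castRingHom] at h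
    exact_mod_cast h
  have hprod : ∏ i, ∑ j, (P * Z) i j ^ 2 =
      ((∑ j, (Z 0 j + Z 1 j) ^ 2) * ∑ j, (Z 0 j - Z 1 j) ^ 2) *
      ((∑ j, (Z 2 j + Z 3 j) ^ 2) * ∑ j, (Z 2 j - Z 3 j) ^ 2) *
      ((∑ j, (Z 4 j + Z 5 j) ^ 2) * ∑ j, (Z 4 j - Z 5 j) ^ 2) := by
    rw [Fin.prod_univ_six]
    simp [P, Matrix.mul_apply, Fin.sum_univ_six (f := fun k => _ * Z k _), sub_eq_add_neg,
      mul_assoc]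
  have h₁ := (hZ 0).norm_add_mul_norm_sub_le (hZ 1)
  have h₂ := (hZ 2).norm_add_mul_norm_sub_le (hZ 3)
  have h₃ := (hZ 4).norm_add_mul_norm_sub_le (hZ 5)
  have hle : ∏ i, ∑ j, (P * Z) i j ^ 2 ≤ 128 * 128 * 128 := by
    rw [hprod]
    have hnonneg : ∀ f g : Fin 6 → ℤ, 0 ≤ (∑ j, f j ^ 2) * ∑ j, g j ^ 2 := fun f g =>
      mul_nonneg (Finset.sum_nonneg fun _ _ => sq_nonneg _)
        (Finset.sum_nonneg fun _ _ => sq_nonneg _)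
    exact mul_le_mul (mul_le_mul h₁ h₂ (hnonneg _ _) (by norm_num)) h₃ (hnonneg _ _)
      (by norm_num)
  rw [Matrix.det_mul, mul_pow, hP] at hH
  linarith

theorem sixty_four_dvd_det {Z : Matrix (Fin 6) (Fin 6) ℤ} (hZ : ∀ i, IsHalfSpinWeight (Z i)) :
    64 ∣ Z.det := by
  have hdiff : ∀ i j, ∃ e, Z i j = Z 0 j + 2 * e := fun i j => by
    rcases (hZ i).1 j with h | h <;> rcases (hZ 0).1 j with h' | h' <;> rw [h, h']
    exacts [⟨0, by norm_num⟩, ⟨1, by norm_num⟩, ⟨-1, by norm_num⟩, ⟨0, by norm_num⟩]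
  choose e he using hdiff
  let c : Fin 6 → ℤ := fun i => if i = 0 then 0 else 1
  let E : Matrix (Fin 6) (Fin 6) ℤ := fun i j => if i = 0 then Z 0 j else e i j
  let d : Fin 6 → ℤ := fun i => if i = 0 then 1 else 2
  have hZE : Z.det = 32 * E.det := by
    have h := Matrix.det_eq_of_forall_row_eq_smul_add_const (A := Z)
      (B := Matrix.diagonal d * E) c 0 (by simp [c]) (fun i j => by
        rw [Matrix.diagonal_mul, Matrix.diagonal_mul]
        by_cases hi : i = 0
        · simp [c, E, d, hi]
        · simp [c, E, d, hi, he i j, add_comm])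
    rw [h, Matrix.det_mul, Matrix.det_diagonal, Fin.prod_univ_six]
    simp [d]
  have hsum : ∀ i, (2 : ℤ) ∣ ∑ j, E i j := fun i => by
    by_cases hi : i = 0
    · have := (hZ 0).2
      simp only [E, hi, if_true]
      omega
    · have h₁ := (hZ i).2
      have h₀ := (hZ 0).2
      simp only [he i, Finset.sum_add_distrib, ← Finset.mul_sum] at h₁
      simp only [E, hi, if_false]
      omega
  have hE : (2 : ℤ) ∣ E.det := by
    have : Fact (Nat.Prime 2) := ⟨Nat.prime_two⟩
    rw [← Nat.cast_ofNat, ← ZMod.intCast_zmod_eq_zero_iff_dvd]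
    have := (Matrix.exists_mulVec_eq_zero_iff (M := E.map (Int.castRingHom (ZMod 2)))).1
      ⟨1, one_ne_zero, by
        ext i
        have := (ZMod.intCast_zmod_eq_zero_iff_dvd (∑ j, E i j) 2).2 (by exact_mod_cast hsum i)
        simpa [Matrix.mulVec, dotProduct] using this⟩
    rw [← RingHom.mapMatrix_apply, ← RingHom.map_det] at this
    simpa using this
  rw [hZE]
  omega

theorem exists_det_eq {Z : Matrix (Fin 6) (Fin 6) ℤ} (hZ : ∀ i, IsHalfSpinWeight (Z i)) :
    ∃ k : ℤ, Z.det = 64 * k ∧ -2 ≤ k ∧ k ≤ 2 := by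
  obtain ⟨k, hk⟩ := sixty_four_dvd_det hZ
  have h := sq_det_le hZ
  rw [hk] at h
  exact ⟨k, hk, by nlinarith, by nlinarith⟩

theorem mem_closure {z : Fin 6 → ℤ} (hz : IsHalfSpinWeight z) :
    z ∈ AddSubgroup.closure {z | IsHalfSpinWeight z} :=
  AddSubgroup.subset_closure hz

theorem parity_of_mem_closure {z : Fin 6 → ℤ}
    (hz : z ∈ AddSubgroup.closure {z | IsHalfSpinWeight z}) :
    (∀ i, (z i - z 0) % 2 = 0) ∧ (∑ i, z i - 2 * z 0) % 4 = 0 := by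
  induction hz using AddSubgroup.closure_induction with
  | mem z hz =>
    have h₂ := hz.2
    refine ⟨fun i => ?_, ?_⟩
    · rcases hz.1 i with h | h <;> rcases hz.1 0 with h' | h' <;> simp [h, h']
    · rcases hz.1 0 with h | h <;> rw [h] <;> omega
  | zero => simp
  | add x y _ _ hx hy =>
    refine ⟨fun i => ?_, ?_⟩
    · have := hx.1 i
      have := hy.1 i
      simp only [Pi.add_apply]
      omega
    · have := hx.2
      have := hy.2
      simp only [Pi.add_apply, Finset.sum_add_distrib]
      omega
  | neg x _ hx =>
    refine ⟨fun i => ?_, ?_⟩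
    · have := hx.1 i
      simp only [Pi.neg_apply]
      omega
    · have := hx.2
      simp only [Pi.neg_apply, Finset.sum_neg_distrib]
      omega

theorem six_le_dotProduct_self_of_mem_closure {z : Fin 6 → ℤ}
    (hz : z ∈ AddSubgroup.closure {z | IsHalfSpinWeight z}) (hne : z ≠ 0) : 6 ≤ z ⬝ᵥ z := by
  obtain ⟨hpar, hsum⟩ := parity_of_mem_closure hz
  rcases Int.emod_two_eq_zero_or_one (z 0) with h₀ | h₀
  · have heven : ∀ i, ∃ y, z i = 2 * y := fun i => ⟨z i / 2, by have := hpar i; omega⟩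
    choose y hy using heven
    have hzy : z ⬝ᵥ z = 4 * (y ⬝ᵥ y) := by
      simp only [dotProduct, Finset.mul_sum]
      exact Finset.sum_congr rfl fun i _ => by rw [hy i]; ring
    have hsq : ∀ i, ∃ k, y i * y i = y i + 2 * k := fun i => by
      obtain ⟨k, hk⟩ := (Int.even_mul_succ_self (y i - 1))
      exact ⟨k, by linarith⟩
    choose k hk using hsq
    have hyy : y ⬝ᵥ y = ∑ i, y i + 2 * ∑ i, k i := by
      simp only [dotProduct, Finset.mul_sum, ← Finset.sum_add_distrib]
      exact Finset.sum_congr rfl fun i _ => hk i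
    have hysum : ∑ i, z i = 2 * ∑ i, y i := by
      simp only [Finset.mul_sum]
      exact Finset.sum_congr rfl fun i _ => hy i
    have hnonneg : 0 ≤ y ⬝ᵥ y := Finset.sum_nonneg fun i _ => mul_self_nonneg (y i)
    have hyne : y ⬝ᵥ y ≠ 0 := fun h => hne <| by
      rw [dotProduct_self_eq_zero] at h
      ext i
      simp [hy i, h]
    have := hy 0
    omega
  · have hone : ∀ i, 1 ≤ z i * z i := fun i => by
      have hi : z i ≠ 0 := by
        have := hpar i
        omega
      have := mul_self_pos.2 hi
      omega
    calc (6 : ℤ) = ∑ _i : Fin 6, (1 : ℤ) := by simp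
      _ ≤ z ⬝ᵥ z := Finset.sum_le_sum fun i _ => hone i

/-- Choosing the signs one at a time keeps signed sums of weights short. -/
theorem exists_sign_dotProduct_self_le {Z : Fin 6 → Fin 6 → ℤ} (hZ : ∀ i, IsHalfSpinWeight (Z i))
    (X : Finset (Fin 6)) :
    ∃ σ : Fin 6 → ℤ, (∀ i, σ i = 1 ∨ σ i = -1) ∧
      (∑ i ∈ X, σ i • Z i) ⬝ᵥ (∑ i ∈ X, σ i • Z i) ≤ 6 * X.card ∧
      (2 ≤ X.card → (∑ i ∈ X, σ i • Z i) ⬝ᵥ (∑ i ∈ X, σ i • Z i) ≤ 6 * X.card - 4) := by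
  induction X using Finset.induction_on with
  | empty => exact ⟨1, by simp, by simp, by simp⟩
  | insert a X ha ih =>
    obtain ⟨σ, hσ, hle, hlt⟩ := ih
    set x := ∑ i ∈ X, σ i • Z i with hx
    obtain ⟨ε, hε, hεle⟩ : ∃ ε : ℤ, (ε = 1 ∨ ε = -1) ∧ ε * (x ⬝ᵥ Z a) = -|x ⬝ᵥ Z a| := by
      rcases le_total 0 (x ⬝ᵥ Z a) with h | h
      · exact ⟨-1, by simp, by simp [abs_of_nonneg h]⟩
      · exact ⟨1, by simp, by simp [abs_of_nonpos h]⟩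
    have hsum : ∑ i ∈ insert a X, Function.update σ a ε i • Z i = ε • Z a + x := by
      rw [Finset.sum_insert ha, Function.update_self, hx]
      congr 1
      refine Finset.sum_congr rfl fun i hi => ?_
      rw [Function.update_of_ne (ne_of_mem_of_not_mem hi ha)]
    have hnorm : (ε • Z a + x) ⬝ᵥ (ε • Z a + x) = 6 + x ⬝ᵥ x - 2 * |x ⬝ᵥ Z a| := by
      have hεε : ε * ε = 1 := by rcases hε with rfl | rfl <;> rfl
      have hself := (hZ a).dotProduct_self
      simp only [add_dotProduct, dotProduct_add, smul_dotProduct, dotProduct_smul, smul_eq_mul,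
        dotProduct_comm (Z a) x, hself]
      linear_combination 6 * hεε + 2 * hεle
    refine ⟨Function.update σ a ε, fun i => ?_, ?_⟩
    · rcases eq_or_ne i a with rfl | hi
      · simpa using hε
      · simpa [hi] using hσ i
    rw [hsum, hnorm, Finset.card_insert_of_notMem ha]
    have habs := abs_nonneg (x ⬝ᵥ Z a)
    push_cast
    refine ⟨by linarith, fun hcard => ?_⟩
    rcases (show X.card = 1 ∨ 2 ≤ X.card by omega) with h | h
    · obtain ⟨c, rfl⟩ := Finset.card_eq_one.1 h
      have hodd : 2 ≤ |x ⬝ᵥ Z a| := by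
        have hdot := (hZ c).dotProduct_emod_four (hZ a)
        have hxc : |x ⬝ᵥ Z a| = |Z c ⬝ᵥ Z a| := by
          rcases hσ c with h' | h' <;> simp [hx, h']
        rw [hxc]
        rcases abs_cases (Z c ⬝ᵥ Z a) with ⟨h', _⟩ | ⟨h', _⟩ <;> omega
      rw [h] at hle ⊢
      push_cast at hle ⊢
      linarith
    · linarith [hlt h]

theorem forall_even_or_forall_odd_of_two_smul_eq {Z : Matrix (Fin 6) (Fin 6) ℤ}
    (hZ : ∀ i, IsHalfSpinWeight (Z i)) (hdet : Z.det ≠ 0) {z : Fin 6 → ℤ}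
    (hz : IsHalfSpinWeight z) {n : Fin 6 → ℤ} (hn : 2 • z = ∑ i, n i • Z i) :
    (∀ i, Even (n i)) ∨ ∀ i, Odd (n i) := by
  by_contra! hcon
  obtain ⟨⟨i₀, hi₀⟩, ⟨i₁, hi₁⟩⟩ := hcon
  rw [Int.not_even_iff_odd] at hi₀
  let X : Finset (Fin 6) := {i | Odd (n i)}
  have hXpos : 0 < X.card := Finset.card_pos.2 ⟨i₀, by simp [X, hi₀]⟩
  have hXlt : X.card < 6 := by
    simpa using Finset.card_lt_univ_of_notMem (s := X) (x := i₁) (by simpa [X] using hi₁)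
  have hXeven : Even X.card := by
    have hparity : ∀ i, ∃ t, n i * Z i 0 = (if i ∈ X then 1 else 0) + 2 * t := fun i => by
      have hodd : Odd (Z i 0) := by rcases (hZ i).1 0 with h | h <;> rw [h] <;> decide
      by_cases hi : Odd (n i)
      · obtain ⟨t, ht⟩ := hi.mul hodd
        exact ⟨t, by simp [X, hi, ht, add_comm]⟩
      · obtain ⟨t, ht⟩ := (Int.not_odd_iff_even.1 hi).mul_right (Z i 0)
        exact ⟨t, by simp [X, hi, ht, two_mul]⟩
    choose t ht using hparity
    have h₀ : 2 * z 0 = ∑ i, n i * Z i 0 := by simpa using congrFun hn 0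
    have hcard : 2 * z 0 = X.card + 2 * ∑ i, t i := by
      simp [h₀, ht, Finset.sum_add_distrib, Finset.mul_sum]
    rw [Nat.even_iff]
    omega
  obtain ⟨r, hr⟩ := hXeven
  obtain ⟨σ, hσ, -, hshort⟩ := exists_sign_dotProduct_self_le hZ X
  have hhalf : ∀ i, ∃ m, n i - (if i ∈ X then σ i else 0) = 2 * m := fun i => by
    rw [← even_iff_exists_two_mul]
    by_cases hi : Odd (n i)
    · have : Odd (σ i) := by rcases hσ i with h | h <;> rw [h] <;> decide
      simpa [X, hi] using hi.sub_odd this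
    · rw [if_neg (by simpa [X] using hi), sub_zero]
      exact Int.not_odd_iff_even.1 hi
  choose m hm using hhalf
  let y : Fin 6 → ℤ := z - ∑ i, m i • Z i
  have hy : y ∈ AddSubgroup.closure {z | IsHalfSpinWeight z} :=
    sub_mem hz.mem_closure <| sum_mem fun i _ =>
      zsmul_mem (hZ i).mem_closure _
  have hx : ∑ i ∈ X, σ i • Z i = ∑ i, (if i ∈ X then σ i else 0) • Z i := by
    simp [ite_smul]
  have hxy : ∑ i ∈ X, σ i • Z i = (2 : ℤ) • y := by
    have h₂ : ∀ i, (2 : ℤ) • m i • Z i = n i • Z i - (if i ∈ X then σ i else 0) • Z i :=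
      fun i => by rw [smul_smul, ← hm i, sub_smul]
    have hn' : (2 : ℤ) • z = ∑ i, n i • Z i := by rw [← hn]; simp [two_smul]
    simp only [y]
    rw [smul_sub, Finset.smul_sum, Finset.sum_congr rfl fun i _ => h₂ i, Finset.sum_sub_distrib,
      hn', hx]
    abel
  have hy₀ : y = 0 := by
    by_contra hne
    have h₆ := six_le_dotProduct_self_of_mem_closure hy hne
    have h₂ := hshort (by omega)
    rw [hxy] at h₂
    simp only [smul_dotProduct, dotProduct_smul, smul_eq_mul] at h₂
    omega
  have hvec : Matrix.vecMul (fun i => if i ∈ X then σ i else 0) Z = 0 := by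
    rw [Matrix.vecMul_eq_sum]
    simpa [hy₀, hx] using hxy
  have h₀ := congrFun (Matrix.eq_zero_of_vecMul_eq_zero hdet hvec) i₀
  rcases hσ i₀ with h | h <;> simp [X, hi₀, h] at h₀

theorem exists_two_smul_eq {Z : Matrix (Fin 6) (Fin 6) ℤ} (hZ : ∀ i, IsHalfSpinWeight (Z i))
    (hdet : Z.det ≠ 0) {z : Fin 6 → ℤ} (hz : IsHalfSpinWeight z) :
    ∃ n : Fin 6 → ℤ, 2 • z = ∑ i, n i • Z i ∧
      ((∀ i, Even (n i)) ∨ ∀ i, n i = 1 ∨ n i = -1) := by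
  obtain ⟨k, hk, hk₁, hk₂⟩ := exists_det_eq hZ
  have hrow : ∀ i, ∃ l : ℤ, (Z.updateRow i z).det = 64 * l ∧ -2 ≤ l ∧ l ≤ 2 := fun i =>
    exists_det_eq fun j => by
      rcases eq_or_ne j i with rfl | hj
      · simpa using hz
      · simpa [Matrix.updateRow_ne hj] using hZ j
  choose l hl hl₁ hl₂ using hrow
  have hcramer : k • z = ∑ i, l i • Z i := by
    have h := Matrix.mulVec_cramer Z.transpose z
    have hc : Matrix.cramer Z.transpose z = fun i => 64 * l i := by
      ext i
      rw [Matrix.cramer_transpose_apply, hl i]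
    rw [hc, Matrix.mulVec_transpose, Matrix.vecMul_eq_sum, Matrix.det_transpose, hk] at h
    simp only [mul_smul, ← Finset.smul_sum] at h
    exact (smul_right_injective _ (by norm_num : (64 : ℤ) ≠ 0) h).symm
  have hk₀ : k ≠ 0 := fun h => hdet (by simp [hk, h])
  have hcases : k = 1 ∨ k = -1 ∨ k = 2 ∨ k = -2 := by omega
  have hunit : ∀ ε : ℤ, ε * k = 1 → ∃ n : Fin 6 → ℤ, 2 • z = ∑ i, n i • Z i ∧
      ((∀ i, Even (n i)) ∨ ∀ i, n i = 1 ∨ n i = -1) := fun ε hε => by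
    refine ⟨fun i => 2 * (ε * l i), ?_, Or.inl fun i => even_two_mul _⟩
    simp only [mul_smul, ← Finset.smul_sum, ← hcramer]
    rw [smul_smul ε k, hε]
    simp [two_smul]
  have htwo : ∀ ε : ℤ, (ε = 1 ∨ ε = -1) → ε * k = 2 → ∃ n : Fin 6 → ℤ, 2 • z = ∑ i, n i • Z i ∧
      ((∀ i, Even (n i)) ∨ ∀ i, n i = 1 ∨ n i = -1) := fun ε hε hεk => by
    have hn : 2 • z = ∑ i, (ε * l i) • Z i := by
      simp only [mul_smul, ← Finset.smul_sum, ← hcramer]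
      rw [smul_smul ε k, hεk]
      simp [two_smul]
    refine ⟨fun i => ε * l i, hn, (forall_even_or_forall_odd_of_two_smul_eq hZ hdet hz hn).imp id ?_⟩
    intro hodd i
    have h₁ := hl₁ i
    have h₂ := hl₂ i
    obtain ⟨t, ht⟩ : Odd (ε * l i) := hodd i
    change ε * l i = 1 ∨ ε * l i = -1
    rcases hε with rfl | rfl <;> omega
  rcases hcases with h | h | h | h
  · exact hunit 1 (by omega)
  · exact hunit (-1) (by omega)
  · exact htwo 1 (by simp) (by omega)
  · exact htwo (-1) (by simp) (by omega)

end IsHalfSpinWeight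

/-- The weights of the half-spin module, scaled by `2`, as rational vectors. -/
def halfSpinWeights : Set (Fin 6 → ℚ) :=
  {v | ∃ z : Fin 6 → ℤ, IsHalfSpinWeight z ∧ v = fun i => (z i : ℚ)}

theorem mem_halfSpinWeights_of_even {v : Fin 6 → ℚ} (hv : ∀ i, v i = 1 ∨ v i = -1)
    (heven : Even (Finset.univ.filter (fun i => v i = -1)).card) : v ∈ halfSpinWeights := by
  refine ⟨fun i => 1 - 2 * if v i = -1 then 1 else 0, ⟨fun i => ?_, ?_⟩, ?_⟩
  · by_cases h : v i = -1 <;> simp [h]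
  · obtain ⟨r, hr⟩ := heven
    rw [Finset.sum_sub_distrib, ← Finset.mul_sum, Finset.sum_boole, hr]
    simp
    omega
  · ext i
    rcases hv i with h | h <;> norm_num [h]

theorem span_halfSpinWeights : Submodule.span ℚ halfSpinWeights = ⊤ := by
  have hmem : ∀ z : Fin 6 → ℤ, IsHalfSpinWeight z →
      (fun i => (z i : ℚ)) ∈ Submodule.span ℚ halfSpinWeights :=
    fun z hz => Submodule.subset_span ⟨z, hz, rfl⟩
  let flip (i j : Fin 6) : Fin 6 → ℤ := fun k => if k = i ∨ k = j then -1 else 1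
  have hflip : ∀ i j, i ≠ j → IsHalfSpinWeight (flip i j) := by
    intro i j hij
    refine ⟨fun k => by by_cases h : k = i ∨ k = j <;> simp [flip, h], ?_⟩
    revert i j
    decide
  have hone : IsHalfSpinWeight 1 := ⟨by simp, by simp⟩
  have hsingle : ∀ i, Pi.single i 1 ∈ Submodule.span ℚ halfSpinWeights := by
    intro i
    obtain ⟨j, k, hij, hik, hjk⟩ : ∃ j k : Fin 6, i ≠ j ∧ i ≠ k ∧ j ≠ k := by
      revert i
      decide
    have h := Submodule.smul_mem _ (1 / 4 : ℚ) (Submodule.add_mem _ (Submodule.sub_mem _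
      (Submodule.sub_mem _ (hmem _ hone) (hmem _ (hflip i j hij))) (hmem _ (hflip i k hik)))
      (hmem _ (hflip j k hjk)))
    convert h using 1
    ext l
    rcases eq_or_ne l i with rfl | hi
    · norm_num [flip, hij, hik]
    · rcases eq_or_ne l j with rfl | hj
      · norm_num [flip, hi, hjk]
      · rcases eq_or_ne l k with rfl | hk
        · norm_num [flip, hi, hj]
        · norm_num [flip, hi, hj, hk]
  rw [eq_top_iff, ← (Pi.basisFun ℚ (Fin 6)).span_eq, Submodule.span_le]
  rintro _ ⟨i, rfl⟩
  simpa using hsingle i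

theorem repr_integral_or_half (b : Module.Basis (Fin 6) ℚ (Fin 6 → ℚ))
    (hb : ∀ i, b i ∈ halfSpinWeights) {s : Fin 6 → ℚ} (hs : s ∈ halfSpinWeights) :
    (∀ i, ∃ m : ℤ, b.repr s i = m) ∨ ∀ i, b.repr s i = 1 / 2 ∨ b.repr s i = -1 / 2 := by
  choose Z hZ hbZ using hb
  obtain ⟨z, hz, rfl⟩ := hs
  have hdet : (Matrix.of Z).det ≠ 0 := by
    intro h
    obtain ⟨c, hc, hcZ⟩ := Matrix.exists_vecMul_eq_zero_iff.2 h
    refine hc (funext fun i => ?_)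
    have hsum : ∑ i, (c i : ℚ) • b i = 0 := by
      ext j
      have := congrFun hcZ j
      simp only [Matrix.vecMul, dotProduct, Matrix.of_apply, Pi.zero_apply] at this
      simp only [hbZ, Finset.sum_apply, Pi.smul_apply, smul_eq_mul, Pi.zero_apply]
      exact_mod_cast this
    exact_mod_cast Fintype.linearIndependent_iff.1 b.linearIndependent (fun i => (c i : ℚ)) hsum i
  obtain ⟨n, hn, hcases⟩ := IsHalfSpinWeight.exists_two_smul_eq (Z := Matrix.of Z) hZ hdet hz
  have hrepr : ∀ i, b.repr (fun i => (z i : ℚ)) i = n i / 2 := by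
    have hz' : (fun i => (z i : ℚ)) = ∑ i, (n i / 2 : ℚ) • b i := by
      ext j
      have h : 2 * z j = ∑ i, n i * Z i j := by simpa using congrFun hn j
      have h' : 2 * (z j : ℚ) = ∑ i, (n i : ℚ) * Z i j := by exact_mod_cast h
      simp only [hbZ, Finset.sum_apply, Pi.smul_apply, smul_eq_mul, div_mul_eq_mul_div,
        ← Finset.sum_div, ← h']
      ring
    intro i
    rw [hz', b.repr_sum_self]
  refine hcases.imp (fun h i => ?_) (fun h i => ?_)
  · obtain ⟨m, hm⟩ := h i
    exact ⟨m, by rw [hrepr, hm]; push_cast; ring⟩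
  · rcases h i with h | h <;> simp [hrepr, h]

theorem exists_basis_halfSpinWeights {T : Set (Fin 6 → ℚ)} (hT : LinearIndepOn ℚ id T)
    (hTW : T ⊆ halfSpinWeights) :
    ∃ b : Module.Basis (Fin 6) ℚ (Fin 6 → ℚ), (∀ i, b i ∈ halfSpinWeights) ∧ T ⊆ Set.range b := by
  let b := Module.Basis.extendLe hT hTW span_halfSpinWeights.ge
  let e := b.indexEquiv (Pi.basisFun ℚ (Fin 6))
  refine ⟨b.reindex e, fun i => ?_, ?_⟩
  · rw [Module.Basis.reindex_apply]
    exact Module.Basis.extendLe_subset hT hTW span_halfSpinWeights.ge ⟨_, rfl⟩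
  · rw [Module.Basis.range_reindex]
    exact Module.Basis.subset_extendLe hT hTW span_halfSpinWeights.ge

theorem memQnnSpan.repr_nonneg {n : ℕ} {T : Finset (Fin n → ℚ)} {v : Fin n → ℚ}
    (hv : memQnnSpan T v) {ι : Type*} (b : Module.Basis ι ℚ (Fin n → ℚ))
    (hTb : (T : Set (Fin n → ℚ)) ⊆ Set.range b) (i : ι) :
    0 ≤ b.repr v i ∧ (b i ∉ T → b.repr v i = 0) := by
  classical
  obtain ⟨q, hq, rfl⟩ := hv
  have hcoord : ∀ w ∈ T, b.repr w i = if b i = w then 1 else 0 := by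
    intro w hw
    obtain ⟨j, rfl⟩ := hTb hw
    simp [Finsupp.single_apply, b.injective.eq_iff, eq_comm]
  have hsum : b.repr (∑ w ∈ T, q w • w) i = if b i ∈ T then q (b i) else 0 := by
    rw [map_sum, Finsupp.finsetSum_apply]
    rw [Finset.sum_congr rfl fun w hw => by
      rw [map_smul, Finsupp.smul_apply, hcoord w hw, smul_eq_mul, mul_ite, mul_one, mul_zero]]
    exact Finset.sum_ite_eq T (b i) q
  rw [hsum]
  refine ⟨?_, fun h => if_neg h⟩
  split_ifs
  exacts [hq _, le_rfl]

theorem memZSpan.repr_integral_or_half {n : ℕ} {S : Finset (Fin n → ℚ)} {v : Fin n → ℚ}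
    (hv : memZSpan S v) {ι : Type*} (b : Module.Basis ι ℚ (Fin n → ℚ))
    (hS : ∀ s ∈ S, (∀ i, ∃ m : ℤ, b.repr s i = m) ∨ ∀ i, ∃ m : ℤ, b.repr s i = m + 1 / 2) :
    (∀ i, ∃ m : ℤ, b.repr v i = m) ∨ ∀ i, ∃ m : ℤ, b.repr v i = m + 1 / 2 := by
  obtain ⟨c, rfl⟩ := hv
  refine Finset.sum_induction (fun s : Fin n → ℚ => (c s : ℚ) • s)
    (fun x => (∀ i, ∃ m : ℤ, b.repr x i = m) ∨ ∀ i, ∃ m : ℤ, b.repr x i = m + 1 / 2)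
    ?_ (Or.inl fun i => ⟨0, by simp⟩) fun s hs => ?_
  · rintro x y (hx | hx) (hy | hy)
    · refine Or.inl fun i => ?_
      obtain ⟨m, hm⟩ := hx i
      obtain ⟨k, hk⟩ := hy i
      exact ⟨m + k, by simp [hm, hk]⟩
    · refine Or.inr fun i => ?_
      obtain ⟨m, hm⟩ := hx i
      obtain ⟨k, hk⟩ := hy i
      exact ⟨m + k, by simp [hm, hk]; ring⟩
    · refine Or.inr fun i => ?_
      obtain ⟨m, hm⟩ := hx i
      obtain ⟨k, hk⟩ := hy i
      exact ⟨m + k, by simp [hm, hk]; ring⟩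
    · refine Or.inl fun i => ?_
      obtain ⟨m, hm⟩ := hx i
      obtain ⟨k, hk⟩ := hy i
      exact ⟨m + k + 1, by simp [hm, hk]; ring⟩
  · rcases hS s hs with h | h
    · refine Or.inl fun i => ?_
      obtain ⟨m, hm⟩ := h i
      exact ⟨c s * m, by simp [hm]⟩
    · rcases Int.even_or_odd' (c s) with ⟨k, hk | hk⟩
      · refine Or.inl fun i => ?_
        obtain ⟨m, hm⟩ := h i
        exact ⟨2 * k * m + k, by simp [hm, hk]; ring⟩
      · refine Or.inr fun i => ?_
        obtain ⟨m, hm⟩ := h i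
        exact ⟨2 * k * m + k + m, by simp [hm, hk]; ring⟩

theorem mem_closure_of_repr_nat {n : ℕ} {S : Finset (Fin n → ℚ)} {ι : Type*} [Fintype ι]
    (b : Module.Basis ι ℚ (Fin n → ℚ)) {x : Fin n → ℚ}
    (hint : ∀ i, ∃ m : ℤ, b.repr x i = m) (hnonneg : ∀ i, 0 ≤ b.repr x i)
    (hsupp : ∀ i, b i ∉ S → b.repr x i = 0) :
    x ∈ AddSubmonoid.closure (S : Set (Fin n → ℚ)) := by
  rw [← b.sum_repr x]
  refine sum_mem fun i _ => ?_
  by_cases hi : b i ∈ S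
  · obtain ⟨m, hm⟩ := hint i
    have hm₀ : 0 ≤ m := by exact_mod_cast hm ▸ hnonneg i
    lift m to ℕ using hm₀
    rw [hm, Int.cast_natCast, Nat.cast_smul_eq_nsmul]
    exact nsmul_mem (AddSubmonoid.subset_closure hi) m
  · rw [hsupp i hi, zero_smul]
    exact zero_mem _

/-- The set `M = {(ε1,…,ε6) ∈ ℚ^6 : εi ∈ {1,−1}, the number of i with εi = −1 is even}` is
hereditarily normal: every subset of `M` is saturated. -/
theorem stmt15 :
    ∀ S : Finset (Fin 6 → ℚ),
      (∀ v ∈ S, (∀ i, v i = 1 ∨ v i = -1) ∧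
        Even (Finset.univ.filter (fun i => v i = -1)).card) →
      Saturated S := by
  intro S hS v hvZ hvQ
  have hSW : ∀ s ∈ S, s ∈ halfSpinWeights := fun s hs =>
    mem_halfSpinWeights_of_even (hS s hs).1 (hS s hs).2
  obtain ⟨T, hTS, hT, hvT⟩ := hvQ.exists_linearIndepOn
  obtain ⟨b, hb, hTb⟩ := exists_basis_halfSpinWeights hT fun t ht => hSW t (hTS ht)
  have hnonneg : ∀ i, 0 ≤ b.repr v i := fun i => (hvT.repr_nonneg b hTb i).1
  have hsupp : ∀ i, b i ∉ S → b.repr v i = 0 := fun i hi =>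
    (hvT.repr_nonneg b hTb i).2 fun h => hi (hTS h)
  have hrepr := fun s hs => repr_integral_or_half b hb (hSW s hs)
  refine memNSpan_of_mem_closure ?_
  by_cases hv : ∀ i, ∃ m : ℤ, b.repr v i = m
  · exact mem_closure_of_repr_nat b hv hnonneg hsupp
  have hhalf : ∀ i, ∃ m : ℤ, b.repr v i = m + 1 / 2 := by
    refine (hvZ.repr_integral_or_half b fun s hs => (hrepr s hs).imp id fun h i => ?_).resolve_left
      hv
    rcases h i with h | h
    · exact ⟨0, by simp [h]⟩
    · exact ⟨-1, by rw [h]; norm_num⟩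
  obtain ⟨s, hs, hs₂⟩ : ∃ s ∈ S, ∀ i, b.repr s i = 1 / 2 ∨ b.repr s i = -1 / 2 := by
    by_contra! hcon
    have hSint : ∀ s ∈ S, ∀ i, ∃ m : ℤ, b.repr s i = m := fun s hs =>
      (hrepr s hs).resolve_right fun h => by
        obtain ⟨i, h₁, h₂⟩ := hcon s hs
        exact (h i).elim h₁ h₂
    refine hv fun i => ?_
    obtain ⟨c, rfl⟩ := hvZ
    choose m hm using hSint
    refine ⟨∑ s ∈ S.attach, c s * m s s.2 i, ?_⟩
    rw [← Finset.sum_attach, map_sum, Finsupp.finsetSum_apply]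
    push_cast
    exact Finset.sum_congr rfl fun s _ => by simp [hm s s.2 i]
  have hle : ∀ i, 1 / 2 ≤ b.repr v i := fun i => by
    obtain ⟨m, hm⟩ := hhalf i
    have h₀ := hnonneg i
    rw [hm] at h₀ ⊢
    have : (-1 : ℚ) < m := by linarith
    have hm₀ : 0 ≤ m := by
      have : (-1 : ℤ) < m := by exact_mod_cast this
      omega
    have : (0 : ℚ) ≤ m := by exact_mod_cast hm₀
    linarith
  have hbS : ∀ i, b i ∈ S := fun i => by
    by_contra hi
    linarith [hle i, hsupp i hi]
  rw [← add_sub_cancel s v]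
  refine add_mem (AddSubmonoid.subset_closure hs) <|
    mem_closure_of_repr_nat b (fun i => ?_) (fun i => ?_) fun i hi => absurd (hbS i) hi
  · obtain ⟨m, hm⟩ := hhalf i
    rcases hs₂ i with h | h
    · exact ⟨m, by simp [hm, h]⟩
    · exact ⟨m + 1, by simp [hm, h]; ring⟩
  · have := hle i
    rw [map_sub, Finsupp.sub_apply]
    rcases hs₂ i with h | h <;> rw [h] <;> linarith
end

section
/- Let v1,…,v6 ∈ ℚ^6 be vectors each of whose coordinates is ±1 and each having an even number of coordinates equal to −1. Then det(v1,…,v6) ∈ {0, 64, −64, 128, −128}. Moreover, there exist six such vectors whose determinant equals exactly 64. -/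
open Matrix in
/-- Hadamard's inequality for the rows of a real square matrix. -/
theorem sq_det_le_prod_dotProduct_self {n : ℕ} (M : Matrix (Fin n) (Fin n) ℝ) :
    M.det ^ 2 ≤ ∏ i, M i ⬝ᵥ M i := by
  let b := EuclideanSpace.basisFun (Fin n) ℝ
  let w : Fin n → EuclideanSpace ℝ (Fin n) := fun i => WithLp.toLp 2 (M i)
  have : Fact (Module.finrank ℝ (EuclideanSpace ℝ (Fin n)) = n) := ⟨by simp⟩
  have hdet : b.toBasis.det w = M.det := by
    rw [Module.Basis.det_apply, ← Matrix.det_transpose]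
    rfl
  have hle := b.toBasis.orientation.abs_volumeForm_apply_le w
  rw [Orientation.volumeForm_robust' _ b, hdet] at hle
  calc M.det ^ 2 = |M.det| ^ 2 := (sq_abs _).symm
    _ ≤ (∏ i, ‖w i‖) ^ 2 := by gcongr
    _ = ∏ i, M i ⬝ᵥ M i := by
      rw [← Finset.prod_pow]
      refine Finset.prod_congr rfl fun i _ => ?_
      rw [EuclideanSpace.real_norm_sq_eq]
      simp [w, dotProduct, sq]

open Matrix in
/-- Hadamard's inequality for the rows of a rational square matrix. -/
theorem sq_det_le_prod_dotProduct_self_rat {n : ℕ} (M : Matrix (Fin n) (Fin n) ℚ) :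
    M.det ^ 2 ≤ ∏ i, M i ⬝ᵥ M i := by
  have h := sq_det_le_prod_dotProduct_self (M.map (Rat.castHom ℝ))
  rw [← RingHom.mapMatrix_apply, ← RingHom.map_det] at h
  simp only [RingHom.mapMatrix_apply, dotProduct, Matrix.map_apply, Rat.coe_castHom] at h
  simp only [dotProduct]
  exact_mod_cast h

open Matrix in
/-- Fischer's inequality for a `6 × 6` matrix whose rows are grouped into three pairs, for rows of
squared length `6` that are far enough from orthogonal. -/
theorem sq_det_le_of_dotProduct (M : Matrix (Fin 6) (Fin 6) ℚ) (hself : ∀ i, M i ⬝ᵥ M i = 6)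
    (hpair : ∀ i j, 4 ≤ (M i ⬝ᵥ M j) ^ 2) : M.det ^ 2 ≤ 32 ^ 3 := by
  let c : Fin 6 → Fin 6 → ℚ := fun i j => -(M i ⬝ᵥ M j) / 6
  let W : Matrix (Fin 6) (Fin 6) ℚ := Matrix.of
    ![M 0, M 1 + c 0 1 • M 0, M 2, M 3 + c 2 3 • M 2, M 4, M 5 + c 4 5 • M 4]
  have hdet : W.det = M.det := by
    refine Matrix.det_eq_of_forall_row_eq_smul_add_pred ![c 0 1, 0, c 2 3, 0, c 4 5]
      (fun j => rfl) fun i j => ?_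
    fin_cases i <;> simp [W]
  have hproj (i j : Fin 6) :
      0 ≤ (M j + c i j • M i) ⬝ᵥ (M j + c i j • M i) ∧
        (M j + c i j • M i) ⬝ᵥ (M j + c i j • M i) ≤ 16 / 3 := by
    refine ⟨Finset.sum_nonneg fun _ _ => mul_self_nonneg _, ?_⟩
    simp only [add_dotProduct, dotProduct_add, smul_dotProduct, dotProduct_smul, hself,
      smul_eq_mul, dotProduct_comm (M j) (M i), c]
    linarith [hpair i j]
  rw [← hdet]
  refine (sq_det_le_prod_dotProduct_self_rat W).trans ?_
  rw [Fin.prod_univ_six]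
  change (M 0 ⬝ᵥ M 0) * ((M 1 + c 0 1 • M 0) ⬝ᵥ (M 1 + c 0 1 • M 0)) * (M 2 ⬝ᵥ M 2) *
    ((M 3 + c 2 3 • M 2) ⬝ᵥ (M 3 + c 2 3 • M 2)) * (M 4 ⬝ᵥ M 4) *
    ((M 5 + c 4 5 • M 4) ⬝ᵥ (M 5 + c 4 5 • M 4)) ≤ 32 ^ 3
  obtain ⟨h1, h1'⟩ := hproj 0 1
  obtain ⟨h3, h3'⟩ := hproj 2 3
  obtain ⟨h5, h5'⟩ := hproj 4 5
  simp only [hself]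
  calc _ ≤ (6 : ℚ) * (16 / 3) * 6 * (16 / 3) * 6 * (16 / 3) := by gcongr
    _ = 32 ^ 3 := by norm_num

/-- A sign vector with an even number of negative signs is `1 - 2 b` for an integer vector `b` with
even coordinate sum. -/
theorem exists_int_eq_one_sub_two_mul {n : ℕ} (x : Fin n → ℚ) (hx : ∀ j, x j = 1 ∨ x j = -1)
    (heven : Even (Finset.univ.filter (fun j => x j = -1)).card) :
    ∃ (b : Fin n → ℤ) (k : ℤ), (∀ j, x j = 1 - 2 * (b j : ℚ)) ∧ ∑ j, b j = 2 * k := by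
  obtain ⟨k, hk⟩ := heven
  refine ⟨fun j => if x j = -1 then 1 else 0, k, fun j => ?_, ?_⟩
  · rcases hx j with h | h <;> norm_num [h]
  · rw [Finset.sum_boole, hk]
    push_cast
    ring

/-- A basis of the lattice spanned by the sign vectors of length six with an even number of
negative signs. -/
def evenSignBasis : Matrix (Fin 6) (Fin 6) ℚ :=
  !![1, 1, 1, 1, 1, 1;
     0, 2, 0, 0, 0, -2;
     0, 0, 2, 0, 0, -2;
     0, 0, 0, 2, 0, -2;
     0, 0, 0, 0, 2, -2;
     0, 0, 0, 0, 0, 4]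

theorem det_evenSignBasis : evenSignBasis.det = 64 := by
  rw [Matrix.det_of_isUpperTriangular]
  · simp [evenSignBasis, Fin.prod_univ_six]
    norm_num
  · intro i j hij
    fin_cases i <;> fin_cases j <;> first | rfl | exact absurd hij (by decide)

/-- The determinant of six even sign vectors is an integer multiple of `64`. -/
theorem exists_det_eq_mul_int (M : Matrix (Fin 6) (Fin 6) ℚ) (b : Fin 6 → Fin 6 → ℤ)
    (k : Fin 6 → ℤ) (hM : ∀ i j, M i j = 1 - 2 * (b i j : ℚ)) (hb : ∀ i, ∑ j, b i j = 2 * k i) :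
    ∃ d : ℤ, M.det = 64 * d := by
  let C : Matrix (Fin 6) (Fin 6) ℤ := Matrix.of fun i =>
    ![1 - 2 * b i 0, b i 0 - b i 1, b i 0 - b i 2, b i 0 - b i 3, b i 0 - b i 4, 3 * b i 0 - k i]
  have hmul : M = C.map (Int.castRingHom ℚ) * evenSignBasis := by
    ext i j
    have hsum : ((∑ j, b i j : ℤ) : ℚ) = 2 * k i := by exact_mod_cast hb i
    rw [Fin.sum_univ_six] at hsum
    push_cast at hsum
    rw [hM, Matrix.mul_apply, Fin.sum_univ_six]
    fin_cases j <;> simp [C, evenSignBasis] <;> linarith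
  refine ⟨C.det, ?_⟩
  rw [hmul, Matrix.det_mul, det_evenSignBasis, ← RingHom.mapMatrix_apply, ← RingHom.map_det,
    mul_comm, eq_intCast]

open Matrix in
/-- The inner product of two even sign vectors of length six is congruent to `2` modulo `4`,
hence at least `2` in absolute value. -/
theorem four_le_sq_dotProduct (x y : Fin 6 → ℚ) (a b : Fin 6 → ℤ) (k l : ℤ)
    (hx : ∀ j, x j = 1 - 2 * (a j : ℚ)) (hy : ∀ j, y j = 1 - 2 * (b j : ℚ))
    (ha : ∑ j, a j = 2 * k) (hb : ∑ j, b j = 2 * l) : 4 ≤ (x ⬝ᵥ y) ^ 2 := by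
  have hdot : x ⬝ᵥ y = ((2 * (2 * (1 - k - l + ∑ j, a j * b j) + 1) : ℤ) : ℚ) := by
    have hint : ∑ j, (1 - 2 * a j) * (1 - 2 * b j)
        = 2 * (2 * (1 - k - l + ∑ j, a j * b j) + 1) := by
      simp only [Fin.sum_univ_six] at ha hb ⊢
      linear_combination -2 * ha - 2 * hb
    rw [← hint]
    simp [dotProduct, hx, hy]
  rw [hdot]
  generalize 1 - k - l + ∑ j, a j * b j = m
  have hm : 4 ≤ (2 * (2 * m + 1)) ^ 2 := by
    rcases le_or_gt 0 m with h | h <;> nlinarith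
  exact_mod_cast hm

/-- Let `v1,…,v6 ∈ ℚ^6` be vectors each of whose coordinates is `±1` and each having an
even number of coordinates equal to `−1`. Then the determinant of the matrix with rows
`v1,…,v6` lies in `{0, 64, −64, 128, −128}`; moreover, there exist six such vectors whose
determinant equals exactly `64`. -/
theorem stmt16 :
    (∀ v : Fin 6 → (Fin 6 → ℚ),
      (∀ i j, v i j = 1 ∨ v i j = -1) →
      (∀ i, Even (Finset.univ.filter (fun j => v i j = -1)).card) →
      (Matrix.of v).det = 0 ∨ (Matrix.of v).det = 64 ∨ (Matrix.of v).det = -64 ∨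
        (Matrix.of v).det = 128 ∨ (Matrix.of v).det = -128) ∧
    (∃ v : Fin 6 → (Fin 6 → ℚ),
      (∀ i j, v i j = 1 ∨ v i j = -1) ∧
      (∀ i, Even (Finset.univ.filter (fun j => v i j = -1)).card) ∧
      (Matrix.of v).det = 64) := by
  constructor
  · intro v hv heven
    choose b k hvb hbk using fun i => exists_int_eq_one_sub_two_mul (v i) (hv i) (heven i)
    obtain ⟨d, hd⟩ := exists_det_eq_mul_int (Matrix.of v) b k hvb hbk
    have hbound := sq_det_le_of_dotProduct (Matrix.of v)
      (fun i => by
        have hsq (j : Fin 6) : v i j * v i j = 1 := by rcases hv i j with h | h <;> simp [h]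
        simp [dotProduct, hsq])
      (fun i j => four_le_sq_dotProduct _ _ _ _ _ _ (hvb i) (hvb j) (hbk i) (hbk j))
    rw [hd] at hbound ⊢
    have hdsq : d ^ 2 ≤ 8 := by
      have : (d : ℚ) ^ 2 ≤ 8 := by linarith
      exact_mod_cast this
    have hlower : -2 ≤ d := by nlinarith
    have hupper : d ≤ 2 := by nlinarith
    interval_cases d <;> norm_num
  · refine ⟨![![1, 1, 1, 1, 1, 1],
      ![1, -1, 1, 1, 1, -1],
      ![1, 1, -1, 1, 1, -1],
      ![1, 1, 1, -1, 1, -1],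
      ![1, 1, 1, 1, -1, -1],
      ![1, -1, -1, 1, 1, 1]], fun i j => ?_, fun i => ?_, ?_⟩
    · fin_cases i <;> fin_cases j <;> simp
    · fin_cases i <;> decide +kernel
    · simp [Matrix.det_succ_row_zero, Fin.sum_univ_succ, Fin.succAbove]
      norm_num
end
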